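/- Assume the Riemann Hypothesis. There is an absolute constant C > 0 such that for all sufficiently large t not coinciding with the ordinate of a zero of ζ, |S(t)| ≤ (1/4)·(log t)/(log log t) + C·(log t · log log log t)/(log log t)². -/

import Mathlib

open Complex MeasureTheory Real

/-- The argument function `S(t) = -(1/π) ∫_{1/2}^∞ Im(ζ'/ζ)(σ+it) dσ`. -/
noncomputable def S (t : ℝ) : ℝ :=
  -(1 / π) * ∫ σ in Set.Ioi (1 / 2 : ℝ),
    (deriv riemannZeta ((σ : ℂ) + (t : ℂ) * Complex.I) /
      riemannZeta ((σ : ℂ) + (t : ℂ) * Complex.I)).im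

/-- `t` is the ordinate of a nontrivial zero of the Riemann zeta function. -/
def IsZetaZeroOrdinate (t : ℝ) : Prop :=
  ∃ ρ : ℂ, riemannZeta ρ = 0 ∧ 0 < ρ.re ∧ ρ.re < 1 ∧ ρ.im = t

/-- The normalised sine `sin (π z) / π`. -/
noncomputable def sinPi (z : ℂ) : ℂ := Complex.sin (π * z) / π

/-- The entire function `sin (π z) / (π z)`. -/
noncomputable def sincPi : ℂ → ℂ := dslope sinPi 0

/-- The series `∑ 1 / ((z + n) (z + n + 1)²)`. -/
noncomputable def kerU (z : ℂ) : ℂ := ∑' n : ℕ, 1 / ((z + n) * (z + n + 1) ^ 2)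

/-- The series `∑ 1 / ((z + n)² (z + n + 1))`. -/
noncomputable def kerV (z : ℂ) : ℂ := ∑' n : ℕ, 1 / ((z + n) ^ 2 * (z + n + 1))

/-- Beurling's majorant of the sign function minus `1`, on the right half-plane. -/
noncomputable def kerR (z : ℂ) : ℂ :=
  2 * sinPi z ^ 2 * kerU (z + 1) + 2 * sinPi z * sincPi z / (z + 1) ^ 2

/-- Beurling's majorant of the sign function plus `1`, on the left half-plane, as a function of
the opposite variable. -/
noncomputable def kerL (z : ℂ) : ℂ :=
  2 * sinPi z ^ 2 * kerV (z + 1) + 2 * sincPi z ^ 2 / (z + 1)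

lemma differentiable_sinPi : Differentiable ℂ sinPi := by
  unfold sinPi; fun_prop

lemma differentiable_sincPi : Differentiable ℂ sincPi := by
  have := (differentiableOn_dslope (s := Set.univ) (f := sinPi) (c := 0) Filter.univ_mem).2
    differentiable_sinPi.differentiableOn
  exact differentiableOn_univ.1 this

lemma sincPi_of_ne {z : ℂ} (hz : z ≠ 0) : sincPi z = sinPi z / z := by
  rw [sincPi, dslope_of_ne _ hz, slope_def_field]
  simp [sinPi]

lemma sinPi_neg (z : ℂ) : sinPi (-z) = -sinPi z := by
  simp [sinPi, neg_div]

lemma norm_sinPi_le (z : ℂ) : ‖sinPi z‖ ≤ Real.exp (π * |z.im|) := by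
  have hpi : (1 : ℝ) ≤ π := by linarith [Real.pi_gt_three]
  have h1 : ‖Complex.sin (π * z)‖ ≤ Real.exp (π * |z.im|) := by
    have ha : ‖Complex.exp (-(π * z) * I)‖ ≤ Real.exp (π * |z.im|) := by
      rw [Complex.norm_exp]
      apply Real.exp_le_exp.2
      simp
      exact mul_le_mul_of_nonneg_left (le_abs_self _) Real.pi_pos.le
    have hb : ‖Complex.exp ((π * z) * I)‖ ≤ Real.exp (π * |z.im|) := by
      rw [Complex.norm_exp]
      apply Real.exp_le_exp.2
      simp
      have := mul_le_mul_of_nonneg_left (neg_abs_le z.im) Real.pi_pos.le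
      linarith
    rw [Complex.sin, norm_div, norm_mul, Complex.norm_I]
    have := norm_sub_le (Complex.exp (-(π * z) * I)) (Complex.exp ((π * z) * I))
    rw [Complex.norm_two]
    linarith
  rw [sinPi, norm_div, Complex.norm_real, Real.norm_of_nonneg Real.pi_pos.le]
  exact (div_le_self (norm_nonneg _) hpi).trans h1

lemma le_norm_add_natCast {z : ℂ} {a : ℝ} (hz : a ≤ z.re) (n : ℕ) : n + a ≤ ‖z + n‖ := by
  have := Complex.re_le_norm (z + n)
  simp at this
  linarith

lemma norm_le_norm_add_natCast {z : ℂ} (hz : 0 ≤ z.re) (n : ℕ) : ‖z‖ ≤ ‖z + n‖ := by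
  rw [Complex.norm_def, Complex.norm_def]
  apply Real.sqrt_le_sqrt
  simp [Complex.normSq_apply]
  have : (0 : ℝ) ≤ n := n.cast_nonneg
  nlinarith

lemma summable_aux : Summable fun n : ℕ => (8 : ℝ) / ((n : ℝ) + 1) ^ 2 := by
  have := (summable_nat_add_iff 1).2 (Real.summable_one_div_nat_pow.2 (one_lt_two))
  simpa [div_eq_mul_inv] using this.mul_left 8

lemma norm_term_le {z : ℂ} (hz : 1 / 2 ≤ z.re) (n : ℕ) :
    ‖1 / ((z + n) * (z + n + 1) ^ 2)‖ ≤ 8 / ((n : ℝ) + 1) ^ 2 ∧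
    ‖1 / ((z + n) ^ 2 * (z + n + 1))‖ ≤ 8 / ((n : ℝ) + 1) ^ 2 := by
  have h1 := le_norm_add_natCast hz n
  have h2 : (n : ℝ) + 1 ≤ ‖z + n + 1‖ := by
    have := le_norm_add_natCast hz (n + 1)
    push_cast at this
    rw [← add_assoc] at this
    linarith
  have hn : (0 : ℝ) ≤ n := n.cast_nonneg
  have h3 : ((n : ℝ) + 1) / 2 ≤ ‖z + n‖ := by linarith
  have h4 : 0 < ‖z + n‖ := by linarith
  have h5 : 0 < ‖z + n + 1‖ := by linarith
  simp only [norm_div, norm_one, norm_mul, norm_pow]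
  constructor
  · rw [div_le_div_iff₀ (by positivity) (by positivity), one_mul]
    have : 1 / 2 * ((n : ℝ) + 1) ^ 2 ≤ ‖z + n‖ * ‖z + n + 1‖ ^ 2 := by gcongr; linarith
    nlinarith
  · rw [div_le_div_iff₀ (by positivity) (by positivity), one_mul]
    have : (((n : ℝ) + 1) / 2) ^ 2 * 1 ≤ ‖z + n‖ ^ 2 * ‖z + n + 1‖ := by gcongr; linarith
    nlinarith

lemma summable_kerU {z : ℂ} (hz : 1 / 2 ≤ z.re) :
    Summable fun n : ℕ => 1 / ((z + n) * (z + n + 1) ^ 2) :=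
  Summable.of_norm_bounded summable_aux fun n => (norm_term_le hz n).1

lemma summable_kerV {z : ℂ} (hz : 1 / 2 ≤ z.re) :
    Summable fun n : ℕ => 1 / ((z + n) ^ 2 * (z + n + 1)) :=
  Summable.of_norm_bounded summable_aux fun n => (norm_term_le hz n).2

lemma add_natCast_ne_zero {z : ℂ} (hz : 0 < z.re) (n : ℕ) : z + n ≠ 0 := by
  intro h
  have := congrArg Complex.re h
  simp at this
  have : (0 : ℝ) ≤ n := n.cast_nonneg
  linarith

lemma add_natCast_add_one_ne_zero {z : ℂ} (hz : 0 < z.re) (n : ℕ) : z + n + 1 ≠ 0 := by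
  have := add_natCast_ne_zero hz (n + 1)
  push_cast at this
  rwa [← add_assoc] at this

lemma isOpen_half : IsOpen {z : ℂ | 1 / 2 < z.re} := isOpen_lt continuous_const continuous_re

lemma differentiableAt_kerU {z : ℂ} (hz : 1 / 2 < z.re) : DifferentiableAt ℂ kerU z := by
  have : DifferentiableOn ℂ kerU {z : ℂ | 1 / 2 < z.re} := by
    refine differentiableOn_tsum_of_summable_norm summable_aux (fun n w hw => ?_) isOpen_half
      fun n w hw => (norm_term_le (le_of_lt hw) n).1
    have hw0 : 0 < w.re := by have : 1 / 2 < w.re := hw; linarith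
    have := add_natCast_ne_zero hw0 n
    have := add_natCast_add_one_ne_zero hw0 n
    apply DifferentiableAt.differentiableWithinAt
    fun_prop (disch := simp_all)
  exact (this z hz).differentiableAt (isOpen_half.mem_nhds hz)

lemma differentiableAt_kerV {z : ℂ} (hz : 1 / 2 < z.re) : DifferentiableAt ℂ kerV z := by
  have : DifferentiableOn ℂ kerV {z : ℂ | 1 / 2 < z.re} := by
    refine differentiableOn_tsum_of_summable_norm summable_aux (fun n w hw => ?_) isOpen_half
      fun n w hw => (norm_term_le (le_of_lt hw) n).2
    have hw0 : 0 < w.re := by have : 1 / 2 < w.re := hw; linarith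
    have := add_natCast_ne_zero hw0 n
    have := add_natCast_add_one_ne_zero hw0 n
    apply DifferentiableAt.differentiableWithinAt
    fun_prop (disch := simp_all)
  exact (this z hz).differentiableAt (isOpen_half.mem_nhds hz)

lemma differentiableAt_kerR {z : ℂ} (hz : 0 ≤ z.re) : DifferentiableAt ℂ kerR z := by
  have h1 : z + 1 ≠ 0 := by simpa using add_natCast_ne_zero (z := z + 1) (by simp; linarith) 0
  have h2 : DifferentiableAt ℂ (fun z => kerU (z + 1)) z :=
    (differentiableAt_kerU (z := z + 1) (by simp; linarith)).fun_comp' z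
      (differentiableAt_id.add_const 1)
  have h3 := differentiable_sinPi z
  have h4 := differentiable_sincPi z
  unfold kerR
  fun_prop (disch := simp_all)

lemma differentiableAt_kerL {z : ℂ} (hz : 0 ≤ z.re) : DifferentiableAt ℂ kerL z := by
  have h1 : z + 1 ≠ 0 := by simpa using add_natCast_ne_zero (z := z + 1) (by simp; linarith) 0
  have h2 : DifferentiableAt ℂ (fun z => kerV (z + 1)) z :=
    (differentiableAt_kerV (z := z + 1) (by simp; linarith)).fun_comp' z
      (differentiableAt_id.add_const 1)
  have h3 := differentiable_sinPi z
  have h4 := differentiable_sincPi z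
  unfold kerL
  fun_prop (disch := simp_all)

lemma kerR_of_ne {z : ℂ} (hz : z ≠ 0) :
    kerR z = 2 * sinPi z ^ 2 * (kerU (z + 1) + 1 / (z * (z + 1) ^ 2)) := by
  rw [kerR, sincPi_of_ne hz]
  simp only [div_eq_mul_inv, mul_inv]
  ring

lemma kerL_of_ne {z : ℂ} (hz : z ≠ 0) :
    kerL z = 2 * sinPi z ^ 2 * (kerV (z + 1) + 1 / (z ^ 2 * (z + 1))) := by
  rw [kerL, sincPi_of_ne hz]
  simp only [div_eq_mul_inv, mul_inv]
  ring

lemma tsum_sub_succ {f : ℕ → ℂ} (hs : Summable fun n => f n - f (n + 1))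
    (hf : Filter.Tendsto f Filter.atTop (nhds 0)) : ∑' n, (f n - f (n + 1)) = f 0 := by
  refine ((hs.hasSum_iff_tendsto_nat).2 ?_).tsum_eq
  simp only [Finset.sum_range_sub']
  simpa using tendsto_const_nhds.sub hf

lemma tendsto_natCast_add_inv (z : ℂ) :
    Filter.Tendsto (fun n : ℕ => 1 / (z + n)) Filter.atTop (nhds 0) := by
  simp only [one_div]
  apply Filter.tendsto_inv₀_cobounded.comp
  apply (tendsto_const_add_cobounded z).comp
  exact tendsto_natCast_atTop_cobounded

lemma kerU_add_kerV {z : ℂ} (hz : 1 / 2 ≤ z.re) : kerU z + kerV z = 1 / z ^ 2 := by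
  have h0 : 0 < z.re := by linarith
  rw [kerU, kerV, ← (summable_kerU hz).tsum_add (summable_kerV hz)]
  have key : ∀ n : ℕ, 1 / ((z + n) * (z + n + 1) ^ 2) + 1 / ((z + n) ^ 2 * (z + n + 1)) =
      (1 / (z + n)) ^ 2 - (1 / (z + (n + 1 : ℕ))) ^ 2 - 0 := fun n => by
    have h1 := add_natCast_ne_zero h0 n
    have h2 := add_natCast_add_one_ne_zero h0 n
    push_cast
    rw [← add_assoc]
    field_simp
    ring
  simp only [sub_zero] at key
  have hs := (summable_kerU hz).add (summable_kerV hz)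
  simp only [key] at hs ⊢
  rw [tsum_sub_succ (f := fun n => (1 / (z + n)) ^ 2) hs]
  · simp
  · simpa using (tendsto_natCast_add_inv z).pow 2

/-- The two halves of the kernel add up to twice a squared cardinal sine. -/
lemma kerR_add_kerL {z : ℂ} (hz : 0 ≤ z.re) (h0 : z ≠ 0) :
    kerR z + kerL z = 2 * (sinPi z / z) ^ 2 := by
  have h1 : z + 1 ≠ 0 := by simpa using add_natCast_ne_zero (z := z + 1) (by simp; linarith) 0
  have h := kerU_add_kerV (z := z + 1) (by simp; linarith)
  rw [kerR_of_ne h0, kerL_of_ne h0, eq_sub_of_add_eq h]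
  field_simp
  ring

lemma summable_inv_sq_add {z : ℂ} (hz : 1 / 2 ≤ z.re) :
    Summable fun n : ℕ => 1 / (z + n) ^ 2 := by
  refine Summable.of_norm_bounded summable_aux fun n => ?_
  have h1 := le_norm_add_natCast hz n
  have hn : (0 : ℝ) ≤ n := n.cast_nonneg
  have h4 : 0 < ‖z + n‖ := by linarith
  simp only [norm_div, norm_one, norm_pow]
  rw [div_le_div_iff₀ (by positivity) (by positivity)]
  have : (((n : ℝ) + 1) / 2) ^ 2 ≤ ‖z + n‖ ^ 2 := by gcongr; linarith
  nlinarith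

lemma summable_inv_mul_add {z : ℂ} (hz : 1 / 2 ≤ z.re) :
    Summable fun n : ℕ => 1 / (z + n) - 1 / (z + (n + 1 : ℕ)) := by
  refine Summable.of_norm_bounded summable_aux fun n => ?_
  have h1 := le_norm_add_natCast hz n
  have h2 := le_norm_add_natCast hz (n + 1)
  have hn : (0 : ℝ) ≤ n := n.cast_nonneg
  have h0 : 0 < z.re := by linarith
  have e : 1 / (z + n) - 1 / (z + (n + 1 : ℕ)) = 1 / ((z + n) * (z + (n + 1 : ℕ))) := by
    have h1 := add_natCast_ne_zero h0 n
    have h2 := add_natCast_ne_zero h0 (n + 1)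
    field_simp
    push_cast
    ring
  rw [e]
  simp only [norm_div, norm_one, norm_mul]
  push_cast at h2 ⊢
  have h4 : 0 < ‖z + n‖ := by linarith
  have h5 : 0 < ‖z + (n + 1)‖ := by linarith
  rw [div_le_div_iff₀ (by positivity) (by positivity)]
  have : (((n : ℝ) + 1) / 2) * ((n : ℝ) + 1) ≤ ‖z + n‖ * ‖z + (n + 1)‖ := by
    gcongr <;> linarith
  nlinarith

lemma kerU_eq {z : ℂ} (hz : 1 / 2 ≤ z.re) :
    kerU z = 1 / z - ∑' n : ℕ, 1 / (z + 1 + n) ^ 2 := by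
  have h0 : 0 < z.re := by linarith
  have ht := tsum_sub_succ (f := fun n => 1 / (z + n)) (summable_inv_mul_add hz)
    (tendsto_natCast_add_inv z)
  have hs := summable_inv_sq_add (z := z + 1) (by simp; linarith)
  simp only [Nat.cast_zero, add_zero] at ht
  rw [← ht, ← (summable_inv_mul_add hz).tsum_sub hs, kerU]
  congr 1
  ext n
  have h1 := add_natCast_ne_zero h0 n
  have h2 := add_natCast_add_one_ne_zero h0 n
  push_cast
  rw [← add_assoc, show z + 1 + n = z + n + 1 by ring]
  field_simp
  ring

lemma kerV_eq {z : ℂ} (hz : 1 / 2 ≤ z.re) :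
    kerV z = ∑' n : ℕ, 1 / (z + n) ^ 2 - 1 / z := by
  have h0 : 0 < z.re := by linarith
  have ht := tsum_sub_succ (f := fun n => 1 / (z + n)) (summable_inv_mul_add hz)
    (tendsto_natCast_add_inv z)
  have hs := summable_inv_sq_add hz
  simp only [Nat.cast_zero, add_zero] at ht
  rw [← ht, ← hs.tsum_sub (summable_inv_mul_add hz), kerV]
  congr 1
  ext n
  have h1 := add_natCast_ne_zero h0 n
  have h2 := add_natCast_add_one_ne_zero h0 n
  push_cast
  rw [← add_assoc]
  field_simp
  ring

lemma one_div_mul_sq_le {a b r m : ℝ} (hr : 0 < r) (hm : 0 < m) (ha : r ≤ a) (ha' : m ≤ a)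
    (hb : r ≤ b) (hb' : m ≤ b) :
    1 / (a * b ^ 2) ≤ r ^ (-3 / 2 : ℝ) * m ^ (-3 / 2 : ℝ) := by
  have ha0 : 0 ≤ a := hr.le.trans ha
  have key : r ^ (3 / 2 : ℝ) * m ^ (3 / 2 : ℝ) ≤ a * b ^ 2 := by
    wlog h : r ≤ m generalizing r m
    · rw [mul_comm]; exact this hm hr ha' ha hb' hb (le_of_not_ge h)
    calc r ^ (3 / 2 : ℝ) * m ^ (3 / 2 : ℝ) ≤ m ^ (3 / 2 : ℝ) * m ^ (3 / 2 : ℝ) := by gcongr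
      _ = m * m ^ 2 := by
        rw [← Real.rpow_add hm]; norm_num
        ring
      _ ≤ a * b ^ 2 := by gcongr
  rw [neg_div, Real.rpow_neg hr.le, Real.rpow_neg hm.le, ← mul_inv, one_div]
  exact inv_anti₀ (by positivity) key

lemma summable_weight : Summable fun n : ℕ => ((n : ℝ) + 1) ^ (-3 / 2 : ℝ) := by
  have := (summable_nat_add_iff 1).2 (Real.summable_nat_rpow.2 (show (-3 / 2 : ℝ) < -1 by norm_num))
  simpa using this

lemma norm_tsum_kernel_le {z : ℂ} (hz : 0 ≤ z.re) (h0 : z ≠ 0) :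
    ‖kerU (z + 1)‖ ≤ ‖z‖ ^ (-3 / 2 : ℝ) * ∑' n : ℕ, ((n : ℝ) + 1) ^ (-3 / 2 : ℝ) ∧
    ‖kerV (z + 1)‖ ≤ ‖z‖ ^ (-3 / 2 : ℝ) * ∑' n : ℕ, ((n : ℝ) + 1) ^ (-3 / 2 : ℝ) := by
  have hp : 0 < ‖z‖ := norm_pos_iff.2 h0
  have bd : ∀ n : ℕ, ‖z‖ ≤ ‖z + 1 + n‖ ∧ (n : ℝ) + 1 ≤ ‖z + 1 + n‖ ∧ ‖z‖ ≤ ‖z + 1 + n + 1‖ ∧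
      (n : ℝ) + 1 ≤ ‖z + 1 + n + 1‖ := fun n => by
    have h1 := norm_le_norm_add_natCast hz (n + 1)
    have h2 := norm_le_norm_add_natCast hz (n + 2)
    have h3 := le_norm_add_natCast hz (n + 1)
    have h4 := le_norm_add_natCast hz (n + 2)
    push_cast at h1 h2 h3 h4
    rw [show z + 1 + n = z + (n + 1) by ring, show z + (n + 1) + 1 = z + (n + 2) by ring]
    refine ⟨h1, by linarith, h2, by linarith⟩
  rw [← tsum_mul_left]
  constructor <;>
  · refine tsum_of_norm_bounded (summable_weight.mul_left _).hasSum fun n => ?_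
    obtain ⟨h1, h2, h3, h4⟩ := bd n
    simp only [norm_div, norm_one, norm_mul, norm_pow]
    first
    | exact one_div_mul_sq_le hp (by positivity) h1 h2 h3 h4
    | rw [mul_comm]; exact one_div_mul_sq_le hp (by positivity) h3 h4 h1 h2

lemma exists_norm_ker_le : ∃ K > 0, ∀ z : ℂ, 0 ≤ z.re → 1 ≤ ‖z‖ →
    ‖kerR z‖ ≤ K * Real.exp (2 * π * |z.im|) * ‖z‖ ^ (-3 / 2 : ℝ) ∧
    ‖kerL z‖ ≤ K * Real.exp (2 * π * |z.im|) * ‖z‖ ^ (-3 / 2 : ℝ) := by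
  have hW : 0 ≤ ∑' n : ℕ, ((n : ℝ) + 1) ^ (-3 / 2 : ℝ) := tsum_nonneg fun n => by positivity
  set W := ∑' n : ℕ, ((n : ℝ) + 1) ^ (-3 / 2 : ℝ)
  refine ⟨2 * (W + 1), by positivity, fun z hz h1 => ?_⟩
  have h0 : z ≠ 0 := norm_pos_iff.1 (by linarith)
  have hp : 0 < ‖z‖ := norm_pos_iff.2 h0
  obtain ⟨hU, hV⟩ := norm_tsum_kernel_le hz h0
  have hz1 : ‖z‖ ≤ ‖z + 1‖ := by simpa using norm_le_norm_add_natCast hz 1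
  have h11 : 1 ≤ ‖z + 1‖ := h1.trans hz1
  have hs : ‖sinPi z‖ ^ 2 ≤ Real.exp (2 * π * |z.im|) := by
    calc ‖sinPi z‖ ^ 2 ≤ Real.exp (π * |z.im|) ^ 2 := by gcongr; exact norm_sinPi_le z
      _ = _ := by rw [← Real.exp_nat_mul]; congr 1; push_cast; ring
  have e1 : ‖1 / (z * (z + 1) ^ 2)‖ ≤ ‖z‖ ^ (-3 / 2 : ℝ) := by
    simpa using one_div_mul_sq_le hp one_pos le_rfl h1 hz1 h11
  have e2 : ‖1 / (z ^ 2 * (z + 1))‖ ≤ ‖z‖ ^ (-3 / 2 : ℝ) := by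
    have := one_div_mul_sq_le hp one_pos hz1 h11 le_rfl h1
    rw [mul_comm]
    simpa using this
  have fin : ∀ u v : ℂ, ‖u‖ ≤ ‖z‖ ^ (-3 / 2 : ℝ) * W → ‖v‖ ≤ ‖z‖ ^ (-3 / 2 : ℝ) →
      ‖2 * sinPi z ^ 2 * (u + v)‖ ≤
        2 * (W + 1) * Real.exp (2 * π * |z.im|) * ‖z‖ ^ (-3 / 2 : ℝ) := fun u v hu hv => by
    rw [norm_mul, norm_mul, norm_pow, Complex.norm_two]
    have : ‖u + v‖ ≤ ‖z‖ ^ (-3 / 2 : ℝ) * W + ‖z‖ ^ (-3 / 2 : ℝ) :=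
      (norm_add_le _ _).trans (add_le_add hu hv)
    calc 2 * ‖sinPi z‖ ^ 2 * ‖u + v‖
        ≤ 2 * Real.exp (2 * π * |z.im|) * (‖z‖ ^ (-3 / 2 : ℝ) * W + ‖z‖ ^ (-3 / 2 : ℝ)) := by
          gcongr
      _ = _ := by ring
  rw [kerR_of_ne h0, kerL_of_ne h0]
  exact ⟨fin _ _ hU e1, fin _ _ hV e2⟩

lemma exists_ker_ofReal {x : ℝ} (hx : 0 < x) :
    (∃ r : ℝ, 0 ≤ r ∧ kerR x = r) ∧ (∃ r : ℝ, 0 ≤ r ∧ kerL x = r) := by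
  have h0 : (x : ℂ) ≠ 0 := by exact_mod_cast hx.ne'
  have hs : sinPi x = ((Real.sin (π * x) / π : ℝ) : ℂ) := by rw [sinPi]; push_cast; rfl
  constructor
  · refine ⟨2 * (Real.sin (π * x) / π) ^ 2 * (∑' n : ℕ, 1 / ((x + 1 + n) * (x + 1 + n + 1) ^ 2) +
      1 / (x * (x + 1) ^ 2)), ?_, ?_⟩
    · have : 0 ≤ ∑' n : ℕ, 1 / ((x + 1 + n) * (x + 1 + n + 1) ^ 2) :=
        tsum_nonneg fun n => by positivity
      positivity
    · rw [kerR_of_ne h0, hs, kerU]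
      push_cast
      rfl
  · refine ⟨2 * (Real.sin (π * x) / π) ^ 2 * (∑' n : ℕ, 1 / ((x + 1 + n) ^ 2 * (x + 1 + n + 1)) +
      1 / (x ^ 2 * (x + 1))), ?_, ?_⟩
    · have : 0 ≤ ∑' n : ℕ, 1 / ((x + 1 + n) ^ 2 * (x + 1 + n + 1)) :=
        tsum_nonneg fun n => by positivity
      positivity
    · rw [kerL_of_ne h0, hs, kerV]
      push_cast
      rfl

lemma tsum_int_inv_sq {z : ℂ} (hz : 0 < z.im) :
    ∑' n : ℤ, 1 / (z + n) ^ 2 = π ^ 2 / Complex.sin (π * z) ^ 2 := by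
  have h := iteratedDerivWithin_cot_pi_mul_eq_mul_tsum_div_pow (k := 1) le_rfl
    (z := z) hz
  have hs : Complex.sin (π * z) ≠ 0 := by
    rw [Complex.sin_ne_zero_iff]
    intro k hk
    have : z = k := by
      have hp : (π : ℂ) ≠ 0 := by exact_mod_cast Real.pi_ne_zero
      rw [mul_comm] at hk
      exact mul_right_cancel₀ hp hk
    rw [this] at hz
    simp at hz
  rw [iteratedDerivWithin_one] at h
  rw [derivWithin_of_isOpen UpperHalfPlane.isOpen_upperHalfPlaneSet hz] at h
  have hd : HasDerivAt (fun x : ℂ => π * Complex.cot (π * x))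
      (π * (((-Complex.sin (π * z) * (π * 1)) * Complex.sin (π * z) -
        Complex.cos (π * z) * (Complex.cos (π * z) * (π * 1))) / Complex.sin (π * z) ^ 2)) z := by
    have h1 : HasDerivAt (fun x : ℂ => (π : ℂ) * x) (π * 1) z := (hasDerivAt_id z).const_mul _
    exact (h1.ccos.div h1.csin hs).const_mul _
  rw [hd.deriv] at h
  have h2 := Complex.sin_sq_add_cos_sq (π * z)
  simp only [Nat.factorial, pow_one, Nat.cast_one, mul_one, Nat.reduceAdd, one_mul,
    Nat.succ_eq_add_one, zero_add, neg_mul] at h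
  rw [eq_comm, neg_eq_iff_eq_neg] at h
  rw [h]
  field_simp
  linear_combination h2

lemma tsum_int_split {z : ℂ} (hz : z.re = 0) :
    ∑' n : ℤ, 1 / (z + n) ^ 2 =
      1 / z ^ 2 + ∑' n : ℕ, 1 / (z + 1 + n) ^ 2 + ∑' n : ℕ, 1 / (-z + 1 + n) ^ 2 := by
  have h1 := summable_inv_sq_add (z := z + 1) (by simp [hz]; norm_num)
  have h2 := summable_inv_sq_add (z := -z + 1) (by simp [hz]; norm_num)
  have h1' : Summable fun n : ℕ => 1 / (z + n) ^ 2 := by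
    refine (summable_nat_add_iff 1).1 ?_
    refine h1.congr fun n => ?_
    push_cast
    rw [show z + ((n : ℂ) + 1) = z + 1 + n by ring]
  have e2 : ∀ n : ℕ, 1 / (-z + 1 + n) ^ 2 = 1 / (z + ((-(n + 1 : ℤ) : ℤ) : ℂ)) ^ 2 := fun n => by
    push_cast
    rw [show z + -((n : ℂ) + 1) = -(-z + 1 + n) by ring, neg_sq]
  simp only [e2] at h2 ⊢
  rw [tsum_of_nat_of_neg_add_one (f := fun n : ℤ => 1 / (z + n) ^ 2) (by simpa using h1') h2]
  congr 1
  simp only [Int.cast_natCast]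
  rw [h1'.tsum_eq_zero_add]
  simp only [Nat.cast_zero, add_zero]
  congr 2
  ext n
  push_cast
  congr 2; ring

lemma kerR_sub_kerL {y : ℝ} (hy : 0 < y) :
    kerR (I * y) - kerL (-(I * y)) = -2 := by
  set z : ℂ := I * y with hzdef
  have hre : z.re = 0 := by simp [hzdef]
  have him : 0 < z.im := by simpa [hzdef] using hy
  have h0 : z ≠ 0 := by intro h; rw [h] at him; simp at him
  have hs : Complex.sin (π * z) ≠ 0 := by
    rw [Complex.sin_ne_zero_iff]
    intro k hk
    have h1 : (π * z).im = 0 := by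
      rw [hk]
      simp
    have h2 : (π * z).im = π * y := by simp [hzdef]
    have := mul_pos Real.pi_pos hy
    linarith
  have hp : (π : ℂ) ≠ 0 := by exact_mod_cast Real.pi_ne_zero
  have n1 : z + 1 ≠ 0 := by intro h; have := congrArg Complex.re h; simp [hre] at this
  have n2 : -z + 1 ≠ 0 := by intro h; have := congrArg Complex.re h; simp [hre] at this
  have hA := tsum_int_inv_sq him
  rw [tsum_int_split hre] at hA
  have hU := kerU_eq (z := z + 1) (by simp [hre]; norm_num)
  have hV := kerV_eq (z := -z + 1) (by simp [hre]; norm_num)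
  have hT : ∑' n : ℕ, 1 / (z + 1 + n) ^ 2 =
      1 / (z + 1) ^ 2 + ∑' n : ℕ, 1 / (z + 1 + 1 + n) ^ 2 := by
    rw [(summable_inv_sq_add (z := z + 1) (by simp [hre]; norm_num)).tsum_eq_zero_add]
    simp only [Nat.cast_zero, add_zero]
    congr 2
    ext n
    push_cast
    congr 2; ring
  rw [kerR_of_ne h0, kerL_of_ne (neg_ne_zero.2 h0), sinPi_neg, hU, hV]
  rw [hT] at hA
  set P := ∑' n : ℕ, 1 / (z + 1 + 1 + n) ^ 2
  set Q := ∑' n : ℕ, 1 / (-z + 1 + n) ^ 2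
  rw [sinPi]
  have hA' : P = π ^ 2 / Complex.sin (π * z) ^ 2 - Q - 1 / z ^ 2 - 1 / (z + 1) ^ 2 := by
    rw [← hA]; ring
  rw [hA']
  field_simp
  ring

/-- The Dirichlet kernel `1 + 2 ∑_{k ≤ N} cos (2 k x)`. -/
noncomputable def dirKer (N : ℕ) (x : ℝ) : ℝ :=
  1 + ∑ k ∈ Finset.range N, 2 * Real.cos (2 * (k + 1) * x)

/-- The (unnormalised) Fejér kernel. -/
noncomputable def fejKer (N : ℕ) (x : ℝ) : ℝ := ∑ m ∈ Finset.range N, dirKer m x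

lemma continuous_dirKer (N : ℕ) : Continuous (dirKer N) := by unfold dirKer; fun_prop

lemma continuous_fejKer (N : ℕ) : Continuous (fejKer N) := by
  unfold fejKer; exact continuous_finsetSum _ fun m _ => continuous_dirKer m

lemma sin_mul_dirKer (N : ℕ) (x : ℝ) : Real.sin x * dirKer N x = Real.sin ((2 * N + 1) * x) := by
  induction N with
  | zero => simp [dirKer]
  | succ N ih =>
    have : dirKer (N + 1) x = dirKer N x + 2 * Real.cos (2 * (N + 1) * x) := by
      rw [dirKer, Finset.sum_range_succ, dirKer]; ring
    rw [this, mul_add, ih]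
    have e1 : (2 * (N : ℝ) + 1) * x = 2 * (N + 1) * x - x := by ring
    have e2 : (2 * ((N + 1 : ℕ) : ℝ) + 1) * x = 2 * (N + 1) * x + x := by push_cast; ring
    rw [e1, e2, Real.sin_sub, Real.sin_add]
    ring

lemma sin_sq_mul_fejKer (N : ℕ) (x : ℝ) :
    Real.sin x ^ 2 * fejKer N x = Real.sin (N * x) ^ 2 := by
  induction N with
  | zero => simp [fejKer]
  | succ N ih =>
    have : fejKer (N + 1) x = fejKer N x + dirKer N x := by
      rw [fejKer, Finset.sum_range_succ, fejKer]
    rw [this, mul_add, ih, sq (Real.sin x), mul_assoc, sin_mul_dirKer]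
    have e1 : (2 * (N : ℝ) + 1) * x = N * x + (N * x + x) := by ring
    have e2 : ((N + 1 : ℕ) : ℝ) * x = N * x + x := by push_cast; ring
    rw [e1, e2, Real.sin_add (N * x) (N * x + x), Real.sin_add, Real.cos_add]
    have h1 := Real.sin_sq_add_cos_sq (N * x)
    have h2 := Real.sin_sq_add_cos_sq x
    set a := Real.sin (N * x)
    set b := Real.cos (N * x)
    set c := Real.sin x
    set d := Real.cos x
    linear_combination (-(a ^ 2)) * h2

lemma integral_dirKer (N : ℕ) : ∫ x in (0 : ℝ)..π / 2, dirKer N x = π / 2 := by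
  unfold dirKer
  rw [intervalIntegral.integral_add (by simp) (Continuous.intervalIntegrable (by fun_prop) _ _),
    intervalIntegral.integral_finsetSum
      (fun k _ => Continuous.intervalIntegrable (by fun_prop) _ _)]
  rw [Finset.sum_eq_zero]
  · simp
  · intro k _
    rw [intervalIntegral.integral_const_mul,
      intervalIntegral.integral_comp_mul_left (fun x => Real.cos x) (by positivity), integral_cos]
    have : 2 * ((k : ℝ) + 1) * (π / 2) = ((k + 1 : ℕ) : ℝ) * π := by push_cast; ring
    rw [this, Real.sin_nat_mul_pi]
    simp

lemma integral_fejKer (N : ℕ) : ∫ x in (0 : ℝ)..π / 2, fejKer N x = N * (π / 2) := by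
  unfold fejKer
  rw [intervalIntegral.integral_finsetSum
    (fun k _ => (continuous_dirKer k).intervalIntegrable _ _)]
  simp [integral_dirKer]

lemma integral_sinc_sq_half_natCast_le {N : ℕ} (hN : 0 < N) :
    ∫ x in (0 : ℝ)..(N / 2 : ℝ), Real.sinc (π * x) ^ 2 ≤ 1 / 2 := by
  have hN' : (0 : ℝ) < N := by exact_mod_cast hN
  have h1 : ∫ x in (0 : ℝ)..π / 2, (N : ℝ) ^ 2 * Real.sinc (N * x) ^ 2 ≤
      ∫ x in (0 : ℝ)..π / 2, fejKer N x := by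
    apply intervalIntegral.integral_mono_on_of_le_Ioo (by positivity)
      (Continuous.intervalIntegrable (by fun_prop) _ _)
      ((continuous_fejKer N).intervalIntegrable _ _)
    intro x hx
    have hs := Real.sin_pos_of_pos_of_lt_pi hx.1 (by linarith [hx.2, Real.pi_pos])
    have hsx := Real.sin_le hx.1.le
    have h0 : (N : ℝ) * x ≠ 0 := (mul_pos hN' hx.1).ne'
    have : fejKer N x = Real.sin (N * x) ^ 2 / Real.sin x ^ 2 := by
      rw [← sin_sq_mul_fejKer, mul_div_cancel_left₀ _ (by positivity)]
    rw [this, Real.sinc_of_ne_zero h0, div_pow, mul_pow, ← mul_div_assoc,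
      mul_div_mul_left _ _ (by positivity)]
    gcongr
  have h2 : ∫ x in (0 : ℝ)..(N / 2 : ℝ), Real.sinc (π * x) ^ 2 =
      (N / π) * ∫ x in (0 : ℝ)..π / 2, Real.sinc (N * x) ^ 2 := by
    have e := intervalIntegral.integral_comp_mul_left (a := 0) (b := N / 2)
      (fun x => Real.sinc (N * x) ^ 2) (c := π / N) (by positivity)
    have e' : ∀ x : ℝ, N * (π / N * x) = π * x := fun x => by field_simp
    simp only [e', mul_zero] at e
    rw [e, show π / N * (N / 2) = π / 2 by field_simp, smul_eq_mul, inv_div]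
  rw [intervalIntegral.integral_const_mul, integral_fejKer] at h1
  have hpi := Real.pi_pos
  rw [h2, div_mul_eq_mul_div, div_le_iff₀ hpi]
  nlinarith

lemma integral_sinc_sq_le {R : ℝ} (hR : 0 ≤ R) :
    ∫ x in (0 : ℝ)..R, Real.sinc (π * x) ^ 2 ≤ 1 / 2 := by
  obtain ⟨N, hN⟩ := exists_nat_gt (2 * R)
  have hN0 : 0 < N := by
    have : (0 : ℝ) < N := by linarith
    exact_mod_cast this
  refine le_trans ?_ (integral_sinc_sq_half_natCast_le hN0)
  apply intervalIntegral.integral_mono_interval le_rfl hR (by linarith)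
  · exact Filter.Eventually.of_forall fun x => sq_nonneg _
  · exact Continuous.intervalIntegrable (by fun_prop) _ _

lemma sinc_sq_le {x : ℝ} (hx : 0 ≤ x) : Real.sinc (π * x) ^ 2 ≤ 4 * (1 + x) ^ (-2 : ℝ) := by
  rw [Real.rpow_neg (by positivity), ← div_eq_mul_inv]
  have e : (1 + x) ^ (2 : ℝ) = (1 + x) ^ 2 := by norm_cast
  rw [e, le_div_iff₀ (by positivity), ← mul_pow, show (4 : ℝ) = 2 ^ 2 by norm_num]
  refine sq_le_sq.2 ?_
  rw [abs_mul, abs_of_pos (show (0 : ℝ) < 1 + x by positivity), abs_of_pos (two_pos (α := ℝ))]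
  rcases le_total x 1 with h | h
  · have := abs_le.2 ⟨Real.neg_one_le_sinc (π * x), Real.sinc_le_one (π * x)⟩
    nlinarith [abs_nonneg (Real.sinc (π * x))]
  · have hp : 0 < π * x := by positivity
    have h3 : x ≤ π * x := by nlinarith [Real.pi_gt_three]
    rw [Real.sinc_of_ne_zero hp.ne', abs_div, abs_of_pos hp, div_mul_eq_mul_div,
      div_le_iff₀ hp]
    have := Real.abs_sin_le_one (π * x)
    nlinarith [abs_nonneg (Real.sin (π * x))]

lemma exists_integral_sinc_sq_mul_log_le : ∃ C > 0, ∀ R : ℝ, 0 ≤ R →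
    ∫ x in (0 : ℝ)..R, Real.sinc (π * x) ^ 2 * Real.log (1 + x) ≤ C := by
  refine ⟨16, by norm_num, fun R hR => ?_⟩
  have hc : ContinuousOn (fun x : ℝ => Real.log (1 + x)) (Set.uIcc 0 R) := by
    rw [Set.uIcc_of_le hR]
    apply ContinuousOn.log (by fun_prop)
    intro x hx; have := hx.1; positivity
  have hc2 : ContinuousOn (fun x : ℝ => (1 + x) ^ (-3 / 2 : ℝ)) (Set.uIcc 0 R) := by
    rw [Set.uIcc_of_le hR]
    apply ContinuousOn.rpow_const (by fun_prop)
    intro x hx; left; have := hx.1; positivity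
  calc ∫ x in (0 : ℝ)..R, Real.sinc (π * x) ^ 2 * Real.log (1 + x)
      ≤ ∫ x in (0 : ℝ)..R, 8 * (1 + x) ^ (-3 / 2 : ℝ) := by
        apply intervalIntegral.integral_mono_on hR
        · exact (ContinuousOn.mul (Continuous.continuousOn (by fun_prop)) hc).intervalIntegrable
        · exact (continuousOn_const.mul hc2).intervalIntegrable
        intro x hx
        have h0 : 0 < 1 + x := by linarith [hx.1]
        have hl := Real.log_le_rpow_div h0.le (show (0 : ℝ) < 1 / 2 by norm_num)
        have hl0 : 0 ≤ Real.log (1 + x) := Real.log_nonneg (by linarith [hx.1])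
        calc Real.sinc (π * x) ^ 2 * Real.log (1 + x)
            ≤ (4 * (1 + x) ^ (-2 : ℝ)) * ((1 + x) ^ (1 / 2 : ℝ) / (1 / 2)) := by
              gcongr; exact sinc_sq_le hx.1
          _ = 8 * ((1 + x) ^ (-2 : ℝ) * (1 + x) ^ (1 / 2 : ℝ)) := by ring
          _ = _ := by rw [← Real.rpow_add h0]; norm_num
    _ = 16 * (1 - (1 + R) ^ (-1 / 2 : ℝ)) := by
        rw [intervalIntegral.integral_const_mul,
          intervalIntegral.integral_comp_add_left (fun x => x ^ (-3 / 2 : ℝ)), integral_rpow]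
        · norm_num
          ring
        · right
          refine ⟨by norm_num, ?_⟩
          rw [Set.uIcc_of_le (by linarith)]
          intro h; have := h.1; linarith
    _ ≤ 16 := by
        have : 0 ≤ (1 + R) ^ (-1 / 2 : ℝ) := by positivity
        linarith

lemma kerR_add_kerL_ofReal {x : ℝ} (hx : 0 < x) :
    kerR x + kerL x = ((2 * Real.sinc (π * x) ^ 2 : ℝ) : ℂ) := by
  rw [kerR_add_kerL (by simpa using hx.le) (by exact_mod_cast hx.ne'),
    Real.sinc_of_ne_zero (by positivity), sinPi]
  push_cast
  rw [div_div]

lemma norm_integral_le_of_rpow {f : ℝ → ℂ} {M R : ℝ} (hR : 0 ≤ R) (hM : 0 ≤ M)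
    (hf : ∀ x, 0 ≤ x → ‖f x‖ ≤ M * ((1 + x) / 2) ^ (-3 / 2 : ℝ)) :
    ‖∫ x in (0 : ℝ)..R, f x‖ ≤ 8 * M := by
  have hc2 : ContinuousOn (fun x : ℝ => ((1 + x)) ^ (-3 / 2 : ℝ)) (Set.uIcc 0 R) := by
    rw [Set.uIcc_of_le hR]
    apply ContinuousOn.rpow_const (by fun_prop)
    intro x hx; left; have := hx.1; positivity
  have h2 : (2 : ℝ) ^ (3 / 2 : ℝ) ≤ 4 := by
    calc (2 : ℝ) ^ (3 / 2 : ℝ) ≤ (2 : ℝ) ^ (2 : ℝ) :=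
          Real.rpow_le_rpow_of_exponent_le (by norm_num) (by norm_num)
      _ = 4 := by norm_num
  calc ‖∫ x in (0 : ℝ)..R, f x‖ ≤ ∫ x in (0 : ℝ)..R, 4 * M * (1 + x) ^ (-3 / 2 : ℝ) := by
        apply intervalIntegral.norm_integral_le_of_norm_le hR
        · refine Filter.Eventually.of_forall fun x hx => (hf x hx.1.le).trans ?_
          have h0 : 0 < 1 + x := by linarith [hx.1]
          rw [Real.div_rpow h0.le (by norm_num), neg_div, Real.rpow_neg two_pos.le, div_inv_eq_mul]
          have : 0 ≤ M * (1 + x) ^ (-(3 / 2) : ℝ) := by positivity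
          nlinarith
        · exact (continuousOn_const.mul hc2).intervalIntegrable
    _ = 8 * M * (1 - (1 + R) ^ (-1 / 2 : ℝ)) := by
        rw [intervalIntegral.integral_const_mul,
          intervalIntegral.integral_comp_add_left (fun x => x ^ (-3 / 2 : ℝ)), integral_rpow]
        · norm_num
          ring
        · right
          refine ⟨by norm_num, ?_⟩
          rw [Set.uIcc_of_le (by linarith)]
          intro h; have := h.1; linarith
    _ ≤ 8 * M := by
        have : 0 ≤ (1 + R) ^ (-1 / 2 : ℝ) := by positivity
        nlinarith

/-- The two rectangle identities for a function times the two halves of the kernel, added up. -/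
lemma rect_identity {g : ℂ → ℂ} (hg : ∀ z : ℂ, 0 ≤ z.im → DifferentiableAt ℂ g z) {R Y : ℝ}
    (hR : 0 ≤ R) (hY : 0 ≤ Y) :
    (∫ x in (0 : ℝ)..R, g x * kerR x) + (∫ x in (0 : ℝ)..R, g (-x) * kerL x) =
      (∫ x in (0 : ℝ)..R, g (x + Y * I) * kerR (x + Y * I)) +
      (∫ x in (0 : ℝ)..R, g (-x + Y * I) * kerL (x - Y * I)) -
      I * (∫ y in (0 : ℝ)..Y, g (R + y * I) * kerR (R + y * I)) +
      I * (∫ y in (0 : ℝ)..Y, g (-R + y * I) * kerL (R - y * I)) -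
      2 * I * (∫ y in (0 : ℝ)..Y, g (I * y)) := by
  have e1 := Complex.integral_boundary_rect_eq_zero_of_differentiableOn
    (fun z => g z * kerR z) 0 (R + Y * I) (by
      intro z hz
      simp [Complex.mem_reProdIm, hR, hY] at hz
      exact ((hg z hz.2.1).mul (differentiableAt_kerR hz.1.1)).differentiableWithinAt)
  have e2 := Complex.integral_boundary_rect_eq_zero_of_differentiableOn
    (fun z => g z * kerL (-z)) (-R) (Y * I) (by
      intro z hz
      simp [Complex.mem_reProdIm, hR, hY] at hz
      refine ((hg z hz.2.1).mul ?_).differentiableWithinAt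
      exact (differentiableAt_kerL (z := -z) (by simp; exact hz.1.2)).fun_comp' z
        differentiableAt_id.neg)
  simp only [ofReal_zero, zero_mul, add_zero, zero_add, zero_re, zero_im, add_re, ofReal_re, mul_re,
    I_re, mul_zero, ofReal_im, I_im, mul_one, sub_self, add_im, mul_im, neg_re, neg_im, neg_zero,
    smul_eq_mul] at e1 e2
  have s1 : (∫ x in (-R)..0, g x * kerL (-x)) = ∫ x in (0 : ℝ)..R, g (-x) * kerL x := by
    have := intervalIntegral.integral_comp_neg (a := 0) (b := R) (fun x : ℝ => g x * kerL (-x))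
    simp only [neg_zero, ofReal_neg, neg_neg] at this
    exact this.symm
  have s2 : (∫ x in (-R)..0, g (x + Y * I) * kerL (-(x + Y * I))) =
      ∫ x in (0 : ℝ)..R, g (-x + Y * I) * kerL (x - Y * I) := by
    have := intervalIntegral.integral_comp_neg (a := 0) (b := R)
      (fun x : ℝ => g (x + Y * I) * kerL (-(x + Y * I)))
    simp only [neg_zero, ofReal_neg] at this
    rw [← this]
    congr 1
    ext x
    congr 2
    ring
  have s3 : (∫ y in (0 : ℝ)..Y, g (↑(-R) + y * I) * kerL (-(↑(-R) + y * I))) =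
      ∫ y in (0 : ℝ)..Y, g (-R + y * I) * kerL (R - y * I) := by
    congr 1
    ext x
    push_cast
    congr 2
    ring
  have c1 : IntervalIntegrable (fun y : ℝ => g (y * I) * kerR (y * I)) volume 0 Y := by
    apply ContinuousOn.intervalIntegrable
    rw [Set.uIcc_of_le hY]
    intro y hy
    have h1 : DifferentiableAt ℂ (fun z => g z * kerR z) (y * I) :=
      (hg _ (by simpa using hy.1)).mul (differentiableAt_kerR (by simp))
    exact (ContinuousAt.comp (f := fun y : ℝ => (y : ℂ) * I) h1.continuousAt
      (by fun_prop)).continuousWithinAt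
  have c2 : IntervalIntegrable (fun y : ℝ => g (y * I) * kerL (-(y * I))) volume 0 Y := by
    apply ContinuousOn.intervalIntegrable
    rw [Set.uIcc_of_le hY]
    intro y hy
    have h1 : DifferentiableAt ℂ (fun z => g z * kerL (-z)) (y * I) := by
      refine (hg _ (by simpa using hy.1)).mul ?_
      exact (differentiableAt_kerL (z := -(y * I)) (by simp)).fun_comp' _
        differentiableAt_id.neg
    exact (ContinuousAt.comp (f := fun y : ℝ => (y : ℂ) * I) h1.continuousAt
      (by fun_prop)).continuousWithinAt
  have s4 : (∫ y in (0 : ℝ)..Y, g (y * I) * kerR (y * I)) -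
      (∫ y in (0 : ℝ)..Y, g (y * I) * kerL (-(y * I))) =
      -2 * ∫ y in (0 : ℝ)..Y, g (I * y) := by
    rw [← intervalIntegral.integral_sub c1 c2, ← intervalIntegral.integral_const_mul]
    apply intervalIntegral.integral_congr_ae
    refine Filter.Eventually.of_forall fun y hy => ?_
    rw [Set.uIoc_of_le hY] at hy
    have := kerR_sub_kerL hy.1
    rw [mul_comm I] at this ⊢
    rw [← mul_sub, this]
    ring
  rw [s1, s2, s3] at e2
  linear_combination e1 + e2 + I * s4

lemma le_re_kernel_integral {g : ℂ → ℂ} (hg : ∀ x : ℝ, ContinuousAt g x) {A R Cl : ℝ}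
    (hA : 0 ≤ A) (hre : ∀ x : ℝ, -(A + 1 / 2 * Real.log (1 + |x|)) ≤ (g x).re) (hR : 0 ≤ R)
    (hC : ∫ x in (0 : ℝ)..R, Real.sinc (π * x) ^ 2 * Real.log (1 + x) ≤ Cl) :
    -(A + Cl) ≤
      ((∫ x in (0 : ℝ)..R, g x * kerR x) + (∫ x in (0 : ℝ)..R, g (-x) * kerL x)).re := by
  have i1 : IntervalIntegrable (fun x : ℝ => g x * kerR x) volume 0 R := by
    apply ContinuousOn.intervalIntegrable
    rw [Set.uIcc_of_le hR]
    intro x hx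
    have h1 : ContinuousAt (fun x : ℝ => g x) x :=
      ContinuousAt.comp (f := fun y : ℝ => (y : ℂ)) (hg x) (by fun_prop)
    have h2 : ContinuousAt (fun x : ℝ => kerR x) x :=
      ContinuousAt.comp (f := fun y : ℝ => (y : ℂ))
        (differentiableAt_kerR (z := x) (by simpa using hx.1)).continuousAt (by fun_prop)
    exact (h1.mul h2).continuousWithinAt
  have i2 : IntervalIntegrable (fun x : ℝ => g (-x) * kerL x) volume 0 R := by
    apply ContinuousOn.intervalIntegrable
    rw [Set.uIcc_of_le hR]
    intro x hx
    have h1 : ContinuousAt (fun x : ℝ => g (-x)) x :=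
      ContinuousAt.comp (f := fun y : ℝ => -(y : ℂ)) (by simpa using hg (-x)) (by fun_prop)
    have h2 : ContinuousAt (fun x : ℝ => kerL x) x :=
      ContinuousAt.comp (f := fun y : ℝ => (y : ℂ))
        (differentiableAt_kerL (z := x) (by simpa using hx.1)).continuousAt (by fun_prop)
    exact (h1.mul h2).continuousWithinAt
  have hs : ContinuousOn (fun x : ℝ => Real.sinc (π * x) ^ 2 * Real.log (1 + x))
      (Set.uIcc 0 R) := by
    rw [Set.uIcc_of_le hR]
    refine ContinuousOn.mul (Continuous.continuousOn (by fun_prop)) ?_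
    apply ContinuousOn.log (by fun_prop)
    intro x hx; have := hx.1; positivity
  have hs' : IntervalIntegrable (fun x : ℝ => Real.sinc (π * x) ^ 2) volume 0 R :=
    Continuous.intervalIntegrable (by fun_prop) _ _
  rw [← intervalIntegral.integral_add i1 i2]
  have hreint := intervalIntegral.intervalIntegral_re (i1.add i2)
  have hle : ∫ x in (0 : ℝ)..R, -(2 * A * Real.sinc (π * x) ^ 2 +
      Real.sinc (π * x) ^ 2 * Real.log (1 + x)) ≤
      ∫ x in (0 : ℝ)..R, (g x * kerR x + g (-x) * kerL x).re := by
    apply intervalIntegral.integral_mono_on_of_le_Ioo hR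
    · exact ((hs'.const_mul _).add hs.intervalIntegrable).neg
    · exact ⟨(i1.add i2).1.re, (i1.add i2).2.re⟩
    intro x hx
    obtain ⟨⟨r, hr, er⟩, ⟨l, hl, el⟩⟩ := exists_ker_ofReal hx.1
    have e := kerR_add_kerL_ofReal hx.1
    rw [er, el] at e ⊢
    have e' : r + l = 2 * Real.sinc (π * x) ^ 2 := by exact_mod_cast e
    have h1 := hre x
    have h2 := hre (-x)
    rw [abs_neg] at h2
    rw [abs_of_pos hx.1] at h1 h2
    rw [Complex.add_re, Complex.re_mul_ofReal, Complex.re_mul_ofReal]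
    push_cast at h2
    have h3 := mul_le_mul_of_nonneg_right h1 hr
    have h4 := mul_le_mul_of_nonneg_right h2 hl
    have h5 : -(A + 1 / 2 * Real.log (1 + x)) * (r + l) ≤
      (g x).re * r + (g (-x)).re * l := by linarith
    rw [e'] at h5
    linarith
  rw [intervalIntegral.integral_neg, intervalIntegral.integral_add (hs'.const_mul _)
    hs.intervalIntegrable, intervalIntegral.integral_const_mul] at hle
  have h6 := integral_sinc_sq_le hR
  have h7 : (∫ x in (0 : ℝ)..R, (g x * kerR x + g (-x) * kerL x).re) =
      (∫ x in (0 : ℝ)..R, (g x * kerR x + g (-x) * kerL x)).re := hreint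
  rw [h7] at hle
  nlinarith

lemma exists_contour_bound : ∃ C > 0, ∀ (g : ℂ → ℂ) (A B K Y : ℝ), 1 ≤ Y → 0 ≤ A →
    (∀ z : ℂ, 0 ≤ z.im → DifferentiableAt ℂ g z) →
    (∀ z : ℂ, 0 ≤ z.im → z.im ≤ Y → ‖g z‖ ≤ B * (1 + ‖z‖)) →
    (∀ x : ℝ, ‖g (x + Y * I)‖ ≤ K) →
    (∀ x : ℝ, -(A + 1 / 2 * Real.log (1 + |x|)) ≤ (g x).re) →
    -2 * (∫ y in (0 : ℝ)..Y, g (I * y)).im ≤ A + C + C * K * Real.exp (2 * π * Y) := by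
  obtain ⟨Cl, hCl, hl⟩ := exists_integral_sinc_sq_mul_log_le
  obtain ⟨M, hM, hk⟩ := exists_norm_ker_le
  refine ⟨Cl + 16 * M, by positivity, fun g A B K Y hY hA hg hB hK hre => ?_⟩
  have hY0 : 0 ≤ Y := by linarith
  have hB0 : 0 ≤ B := by
    have := (norm_nonneg _).trans (hB 0 (by simp) (by simpa using hY0))
    simpa using this
  have hK0 : 0 ≤ K := (norm_nonneg _).trans (hK 0)
  set E := Real.exp (2 * π * Y) with hE
  have hE0 : 0 < E := Real.exp_pos _
  have htop : ∀ (k : ℂ → ℂ) (w : ℂ) (u : ℂ), ‖u‖ ≤ K → ‖k w‖ ≤ M * Real.exp (2 * π * |w.im|) *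
      ‖w‖ ^ (-3 / 2 : ℝ) → 0 ≤ w.re → |w.im| = Y →
      ‖u * k w‖ ≤ (K * M * E) * ((1 + w.re) / 2) ^ (-3 / 2 : ℝ) := fun k w u hu hw h0 h1 => by
    rw [h1] at hw
    have h2 := Complex.abs_im_le_norm w
    have h3 := Complex.re_le_norm w
    have h4 : (1 + w.re) / 2 ≤ ‖w‖ := by linarith
    rw [norm_mul]
    calc ‖u‖ * ‖k w‖ ≤ K * (M * E * ‖w‖ ^ (-3 / 2 : ℝ)) := by gcongr
      _ ≤ K * (M * E * ((1 + w.re) / 2) ^ (-3 / 2 : ℝ)) := by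
        have := Real.rpow_le_rpow_of_nonpos (z := -3 / 2) (by positivity) h4 (by norm_num)
        gcongr
      _ = _ := by ring
  have hside : ∀ R : ℝ, 1 ≤ R → ∀ (k : ℂ → ℂ) (w : ℂ) (v : ℂ), ‖v‖ ≤ R + Y → 0 ≤ v.im →
      v.im ≤ Y → ‖k w‖ ≤ M * Real.exp (2 * π * |w.im|) *
      ‖w‖ ^ (-3 / 2 : ℝ) → w.re = R → |w.im| ≤ Y →
      ‖g v * k w‖ ≤ B * (1 + (R + Y)) * (M * E * R ^ (-3 / 2 : ℝ)) :=
        fun R hR k w v hv hv0 hv1 hw h0 h1 => by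
    have h3 := Complex.re_le_norm w
    rw [h0] at h3
    have := Real.rpow_le_rpow_of_nonpos (z := -3 / 2) (by positivity) h3 (by norm_num)
    have h5 : Real.exp (2 * π * |w.im|) ≤ E := by
      apply Real.exp_le_exp.2; gcongr
    rw [norm_mul]
    calc ‖g v‖ * ‖k w‖ ≤ (B * (1 + ‖v‖)) * (M * Real.exp (2 * π * |w.im|) *
          ‖w‖ ^ (-3 / 2 : ℝ)) := by
          gcongr; exact hB v hv0 hv1
      _ ≤ _ := by gcongr
  have key : ∀ R : ℝ, 1 ≤ R → -2 * (∫ y in (0 : ℝ)..Y, g (I * y)).im ≤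
      (A + Cl) + 16 * (K * M * E) +
        2 * (B * (1 + (R + Y)) * (M * E * R ^ (-3 / 2 : ℝ)) * Y) := fun R hR => by
    have hR0 : 0 ≤ R := by linarith
    have h1 := le_re_kernel_integral (fun x => (hg x (by simp)).continuousAt) hA hre hR0
      (hl R hR0)
    rw [rect_identity hg hR0 hY0] at h1
    have n1 := norm_integral_le_of_rpow (f := fun x : ℝ => g (x + Y * I) * kerR (x + Y * I))
      (M := K * M * E) hR0 (by positivity) (fun x hx => by
        have hn : 1 ≤ ‖(x + Y * I : ℂ)‖ := by
          have := Complex.abs_im_le_norm (x + Y * I)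
          simp at this
          rw [abs_of_nonneg hY0] at this
          linarith
        have := htop kerR (x + Y * I) _ (hK x) (hk _ (by simpa using hx) hn).1
          (by simpa using hx) (by simp [abs_of_nonneg hY0])
        simpa using this)
    have n2 := norm_integral_le_of_rpow (f := fun x : ℝ => g (-x + Y * I) * kerL (x - Y * I))
      (M := K * M * E) hR0 (by positivity) (fun x hx => by
        have hn : 1 ≤ ‖(x - Y * I : ℂ)‖ := by
          have := Complex.abs_im_le_norm (x - Y * I)
          simp at this
          rw [abs_of_nonneg hY0] at this
          linarith
        have := htop kerL (x - Y * I) _ (hK (-x)) (hk _ (by simpa using hx) hn).2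
          (by simpa using hx) (by simp [abs_of_nonneg hY0])
        simpa using this)
    have nb : ∀ y : ℝ, 0 ≤ y → y ≤ Y → ‖(R + y * I : ℂ)‖ ≤ R + Y ∧ ‖(-R + y * I : ℂ)‖ ≤ R + Y ∧
        1 ≤ ‖(R + y * I : ℂ)‖ ∧ 1 ≤ ‖(R - y * I : ℂ)‖ := fun y hy hy' => by
      have a1 := norm_add_le (R : ℂ) (y * I)
      have a2 := norm_add_le (-R : ℂ) (y * I)
      have a3 := Complex.re_le_norm (R + y * I)
      have a4 := Complex.re_le_norm (R - y * I)
      simp [abs_of_nonneg hR0, abs_of_nonneg hy] at a1 a2 a3 a4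
      refine ⟨by linarith, by linarith, by linarith, by linarith⟩
    have n3 : ‖∫ y in (0 : ℝ)..Y, g (R + y * I) * kerR (R + y * I)‖ ≤
        B * (1 + (R + Y)) * (M * E * R ^ (-3 / 2 : ℝ)) * Y := by
      have := intervalIntegral.norm_integral_le_of_norm_le_const (a := 0) (b := Y)
        (f := fun y : ℝ => g (R + y * I) * kerR (R + y * I))
        (C := B * (1 + (R + Y)) * (M * E * R ^ (-3 / 2 : ℝ))) (fun y hy => by
          rw [Set.uIoc_of_le hY0] at hy
          obtain ⟨b1, -, b3, -⟩ := nb y hy.1.le hy.2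
          refine hside R hR _ _ _ b1 (by simpa using hy.1.le) (by simpa using hy.2)
            (hk _ (by simpa using hR0) b3).1 (by simp) ?_
          simpa [abs_of_nonneg hy.1.le] using hy.2)
      rwa [sub_zero, abs_of_nonneg hY0] at this
    have n4 : ‖∫ y in (0 : ℝ)..Y, g (-R + y * I) * kerL (R - y * I)‖ ≤
        B * (1 + (R + Y)) * (M * E * R ^ (-3 / 2 : ℝ)) * Y := by
      have := intervalIntegral.norm_integral_le_of_norm_le_const (a := 0) (b := Y)
        (f := fun y : ℝ => g (-R + y * I) * kerL (R - y * I))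
        (C := B * (1 + (R + Y)) * (M * E * R ^ (-3 / 2 : ℝ))) (fun y hy => by
          rw [Set.uIoc_of_le hY0] at hy
          obtain ⟨-, b1, -, b3⟩ := nb y hy.1.le hy.2
          refine hside R hR _ _ _ b1 (by simpa using hy.1.le) (by simpa using hy.2)
            (hk _ (by simpa using hR0) b3).2 (by simp) ?_
          simpa [abs_of_nonneg hy.1.le] using hy.2)
      rwa [sub_zero, abs_of_nonneg hY0] at this
    have r1 := Complex.re_le_norm (∫ x in (0 : ℝ)..R, g (x + Y * I) * kerR (x + Y * I))
    have r2 := Complex.re_le_norm (∫ x in (0 : ℝ)..R, g (-x + Y * I) * kerL (x - Y * I))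
    have r3 := Complex.abs_im_le_norm (∫ y in (0 : ℝ)..Y, g (R + y * I) * kerR (R + y * I))
    have r4 := Complex.abs_im_le_norm (∫ y in (0 : ℝ)..Y, g (-R + y * I) * kerL (R - y * I))
    simp only [add_re, sub_re, mul_re, I_re, I_im, mul_im, zero_mul, one_mul, zero_sub, re_ofNat,
      im_ofNat, mul_zero, mul_one, add_zero, sub_self] at h1
    have r3' := (abs_le.1 r3).2
    have r4' := (abs_le.1 r4).1
    linarith
  have hlim : Filter.Tendsto (fun R : ℝ => (A + Cl) + 16 * (K * M * E) +
        2 * (B * (1 + (R + Y)) * (M * E * R ^ (-3 / 2 : ℝ)) * Y)) Filter.atTop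
        (nhds ((A + Cl) + 16 * (K * M * E) +
        2 * (B * M * E * Y * ((1 + Y) * 0 + 0)))) := by
    have t1 := tendsto_rpow_neg_atTop (show (0 : ℝ) < 3 / 2 by norm_num)
    have t2 := tendsto_rpow_neg_atTop (show (0 : ℝ) < 1 / 2 by norm_num)
    refine Filter.Tendsto.congr' ?_ ((((t1.const_mul (1 + Y)).add t2).const_mul
      (B * M * E * Y)).const_mul 2 |>.const_add ((A + Cl) + 16 * (K * M * E)))
    filter_upwards [Filter.eventually_gt_atTop 0] with R hR
    have : R ^ (-(1 / 2) : ℝ) = R * R ^ (-3 / 2 : ℝ) := by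
      rw [← Real.rpow_one_add' hR.le (by norm_num)]; norm_num
    rw [this, neg_div]
    ring
  have := ge_of_tendsto hlim (Filter.eventually_atTop.2 ⟨1, key⟩)
  have hp : 0 ≤ Cl * K * E := by positivity
  have hp2 : 0 ≤ M := hM.le
  calc _ ≤ _ := this
    _ ≤ _ := by linarith

/-- The fractional part, cut off to the half-line `t > 1`. -/
noncomputable def fractTail : ℝ → ℂ := Set.indicator (Set.Ioi 1) fun t => ((Int.fract t : ℝ) : ℂ)

lemma norm_fractTail_le (t : ℝ) : ‖fractTail t‖ ≤ 1 := by
  unfold fractTail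
  refine (norm_indicator_le_norm_self _ _).trans ?_
  rw [Complex.norm_real, Real.norm_of_nonneg (Int.fract_nonneg t)]
  exact (Int.fract_lt_one t).le

lemma measurable_fractTail : Measurable fractTail := by
  unfold fractTail
  exact (Complex.measurable_ofReal.comp measurable_fract).indicator measurableSet_Ioi

lemma differentiableAt_mellin_fractTail {s : ℂ} (hs : 0 < s.re) :
    DifferentiableAt ℂ (fun s => mellin fractTail (-s)) s := by
  have h : DifferentiableAt ℂ (mellin fractTail) (-s) := by
    refine mellin_differentiableAt_of_isBigO_rpow (a := 0) (b := -s.re - 1) ?_ ?_ (by simpa) ?_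
      (by simp)
    · apply LocallyIntegrable.locallyIntegrableOn
      refine (locallyIntegrable_const (1 : ℝ)).mono
        measurable_fractTail.aestronglyMeasurable ?_
      exact Filter.Eventually.of_forall fun t => by simpa using norm_fractTail_le t
    · simp only [neg_zero, Real.rpow_zero]
      exact Asymptotics.IsBigO.of_bound 1 (Filter.Eventually.of_forall fun t => by
        simpa using norm_fractTail_le t)
    · refine Asymptotics.IsBigO.of_bound 1 ?_
      have : Set.Ioo (0 : ℝ) 1 ∈ nhdsWithin 0 (Set.Ioi (0 : ℝ)) := Ioo_mem_nhdsGT one_pos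
      filter_upwards [this] with t ht
      have : fractTail t = 0 := by
        unfold fractTail
        rw [Set.indicator_of_notMem]
        simpa using ht.2.le
      rw [this, norm_zero]
      positivity
  exact h.fun_comp' s differentiableAt_id.neg

lemma mellin_fractTail (s : ℂ) :
    mellin fractTail (-s) = ∫ t in Set.Ioi (1 : ℝ), (t : ℂ) ^ (-s - 1) * (Int.fract t : ℝ) := by
  rw [mellin, fractTail]
  have : ∀ t : ℝ, (t : ℂ) ^ (-s - 1) • (Set.Ioi (1 : ℝ)).indicator
      (fun t => ((Int.fract t : ℝ) : ℂ)) t =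
      (Set.Ioi (1 : ℝ)).indicator (fun t => (t : ℂ) ^ (-s - 1) * (Int.fract t : ℝ)) t := fun t => by
    by_cases h : t ∈ Set.Ioi (1 : ℝ) <;> simp [h]
  simp only [this]
  rw [setIntegral_indicator measurableSet_Ioi, Set.inter_eq_self_of_subset_right]
  exact Set.Ioi_subset_Ioi zero_le_one

lemma norm_mellin_fractTail_le {s : ℂ} (hs : 0 < s.re) :
    ‖mellin fractTail (-s)‖ ≤ 1 / s.re := by
  rw [mellin_fractTail]
  have h1 : IntegrableOn (fun t : ℝ => t ^ (-s.re - 1)) (Set.Ioi 1) :=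
    integrableOn_Ioi_rpow_of_lt (by linarith) one_pos
  calc _ ≤ ∫ t in Set.Ioi (1 : ℝ), t ^ (-s.re - 1) := by
        refine norm_integral_le_of_norm_le h1 ?_
        refine (ae_restrict_iff' measurableSet_Ioi).2 (Filter.Eventually.of_forall fun t ht => ?_)
        have ht0 : (0 : ℝ) < t := lt_trans one_pos ht
        rw [norm_mul, Complex.norm_cpow_eq_rpow_re_of_pos ht0, Complex.norm_real,
          Real.norm_of_nonneg (Int.fract_nonneg t)]
        have := (Int.fract_lt_one t).le
        simpa using mul_le_of_le_one_right (by positivity) this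
    _ = 1 / s.re := by
        rw [integral_Ioi_rpow_of_lt (by linarith) one_pos]
        simp

lemma riemannZeta₁_eq_of_one_lt {s : ℂ} (hs : 1 < s.re) :
    riemannZeta₁ s = s - s * (s - 1) * mellin fractTail (-s) := by
  have hs1 : s ≠ 1 := by rintro rfl; simp at hs
  have hs1' : s - 1 ≠ 0 := sub_ne_zero.2 hs1
  have h := LSeries_eq_mul_integral 1 (r := 1) zero_le_one hs
    (LSeriesSummable_one_iff.2 hs) (by
      refine Asymptotics.IsBigO.of_bound 1 (Filter.Eventually.of_forall fun n => ?_)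
      simp)
  rw [LSeries_one_eq_riemannZeta hs, riemannZeta_eq_inv_sub_mul hs1] at h
  have hi : ∫ t in Set.Ioi (1 : ℝ), (∑ k ∈ Finset.Icc 1 ⌊t⌋₊, (1 : ℕ → ℂ) k) * (t : ℂ) ^ (-(s + 1)) =
      1 / (s - 1) - mellin fractTail (-s) := by
    have i1 : IntegrableOn (fun t : ℝ => (t : ℂ) ^ (-s)) (Set.Ioi 1) :=
      integrableOn_Ioi_cpow_of_lt (by simpa) one_pos
    have i2 : IntegrableOn (fun t : ℝ => (t : ℂ) ^ (-s - 1) * (Int.fract t : ℝ)) (Set.Ioi 1) := by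
      have h1 : IntegrableOn (fun t : ℝ => t ^ (-s.re - 1)) (Set.Ioi 1) :=
        integrableOn_Ioi_rpow_of_lt (by linarith) one_pos
      refine Integrable.mono' h1 ?_ ?_
      · refine AEStronglyMeasurable.mul ?_ ?_
        · apply ContinuousOn.aestronglyMeasurable _ measurableSet_Ioi
          intro t ht
          have ht0 : (0 : ℝ) < t := lt_trans one_pos ht
          exact (Complex.continuousAt_ofReal_cpow_const _ _ (Or.inr ht0.ne')).continuousWithinAt
        · exact (Complex.measurable_ofReal.comp measurable_fract).aestronglyMeasurable
      · refine (ae_restrict_iff' measurableSet_Ioi).2 (Filter.Eventually.of_forall fun t ht => ?_)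
        have ht0 : (0 : ℝ) < t := lt_trans one_pos ht
        rw [norm_mul, Complex.norm_cpow_eq_rpow_re_of_pos ht0, Complex.norm_real,
          Real.norm_of_nonneg (Int.fract_nonneg t)]
        have := (Int.fract_lt_one t).le
        simpa using mul_le_of_le_one_right (by positivity) this
    rw [mellin_fractTail]
    have e : 1 / (s - 1) = ∫ t in Set.Ioi (1 : ℝ), (t : ℂ) ^ (-s) := by
      rw [integral_Ioi_cpow_of_lt (by simpa) one_pos]
      rw [show -s + 1 = -(s - 1) by ring, ofReal_one, Complex.one_cpow, neg_div_neg_eq]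
    rw [e, ← integral_sub i1 i2]
    apply setIntegral_congr_fun measurableSet_Ioi
    intro t ht
    have ht0 : (0 : ℝ) < t := lt_trans one_pos ht
    have ht0' : (t : ℂ) ≠ 0 := by exact_mod_cast ht0.ne'
    have e1 : (t : ℂ) ^ (-s) = t ^ (-s - 1) * t := by
      rw [Complex.cpow_sub _ _ ht0', Complex.cpow_one, div_mul_cancel₀ _ ht0']
    have e2 : ((Int.fract t : ℝ) : ℂ) = t - ⌊t⌋₊ := by
      rw [Int.fract, ← natCast_floor_eq_intCast_floor ht0.le]
      push_cast; rfl
    simp only [e2, e1]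
    rw [show -(s + 1) = -s - 1 by ring]
    simp
    ring
  rw [hi] at h
  field_simp at h
  rw [h]
  ring

lemma riemannZeta₁_eq {s : ℂ} (hs : 0 < s.re) :
    riemannZeta₁ s = s - s * (s - 1) * mellin fractTail (-s) := by
  have hU : IsOpen {s : ℂ | 0 < s.re} := isOpen_lt continuous_const continuous_re
  have h2 : DifferentiableOn ℂ (fun s => s - s * (s - 1) * mellin fractTail (-s))
      {s : ℂ | 0 < s.re} := fun s hs => by
    have := differentiableAt_mellin_fractTail hs
    exact DifferentiableAt.differentiableWithinAt (by fun_prop)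
  have h1 : DifferentiableOn ℂ riemannZeta₁ {s : ℂ | 0 < s.re} :=
    differentiable_riemannZeta₁.differentiableOn
  refine (h1.analyticOnNhd hU).eqOn_of_preconnected_of_eventuallyEq (h2.analyticOnNhd hU)
    (convex_halfSpace_re_gt 0).isPreconnected (z₀ := 2) (by simp) ?_ hs
  have : {s : ℂ | 1 < s.re} ∈ nhds (2 : ℂ) :=
    (isOpen_lt continuous_const continuous_re).mem_nhds (by simp)
  filter_upwards [this] with s hs using riemannZeta₁_eq_of_one_lt hs

/-- Polynomial growth of `(s - 1) ζ(s)` in a half-plane. -/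
lemma norm_riemannZeta₁_le {s : ℂ} (hs : 1 / 4 ≤ s.re) :
    ‖riemannZeta₁ s‖ ≤ 5 * (1 + ‖s‖) ^ 2 := by
  rw [riemannZeta₁_eq (by linarith)]
  have h1 := norm_mellin_fractTail_le (s := s) (by linarith)
  have h2 : 1 / s.re ≤ 4 := by
    rw [div_le_iff₀ (by linarith)]; linarith
  have h3 : ‖s - 1‖ ≤ ‖s‖ + 1 := by simpa using norm_sub_le s 1
  calc _ ≤ ‖s‖ + ‖s * (s - 1) * mellin fractTail (-s)‖ := norm_sub_le _ _
    _ ≤ ‖s‖ + ‖s‖ * (‖s‖ + 1) * 4 := by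
      rw [norm_mul, norm_mul]
      gcongr
      exact h1.trans h2
    _ ≤ _ := by nlinarith [norm_nonneg s]

/-- A minorant, with telescoping sums, of `j / (j + m) ^ 2`. -/
noncomputable def teleMin (m : ℝ) (j : ℕ) : ℝ :=
  (Real.log ((j + 1 : ℕ) + m) - Real.log (j + m)) -
    m * (1 / ((j : ℝ) + m - 1) - 1 / ((j + 1 : ℕ) + m - 1))

lemma teleMin_le {m : ℝ} (hm : 2 ≤ m) (j : ℕ) : teleMin m j ≤ j / (j + m) ^ 2 := by
  have hj : (0 : ℝ) ≤ j := j.cast_nonneg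
  have h0 : 0 < (j : ℝ) + m := by linarith
  have h1 : 0 < (j : ℝ) + m - 1 := by linarith
  have hlog : Real.log ((j + 1 : ℕ) + m) - Real.log (j + m) ≤ 1 / (j + m) := by
    rw [← Real.log_div (by push_cast; positivity) h0.ne']
    refine (Real.log_le_sub_one_of_pos (by push_cast; positivity)).trans (le_of_eq ?_)
    push_cast
    field_simp
    ring
  have h2 : 1 / ((j : ℝ) + m) ^ 2 ≤ 1 / ((j : ℝ) + m - 1) - 1 / ((j + 1 : ℕ) + m - 1) := by
    have : 1 / ((j : ℝ) + m - 1) - 1 / ((j + 1 : ℕ) + m - 1) =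
        1 / (((j : ℝ) + m - 1) * (j + m)) := by
      push_cast
      rw [show (j : ℝ) + 1 + m - 1 = j + m by ring]
      field_simp
      ring
    rw [this]
    apply one_div_le_one_div_of_le (by positivity)
    nlinarith
  have h3 := mul_le_mul_of_nonneg_left h2 (show 0 ≤ m by linarith)
  have h4 : (j : ℝ) / (j + m) ^ 2 = 1 / (j + m) - m * (1 / (j + m) ^ 2) := by
    field_simp
    ring
  rw [teleMin, h4]
  linarith

lemma le_sum_teleMin {m : ℝ} (hm : 2 ≤ m) {n : ℕ} (hn : 0 < n) :
    Real.log n - Real.log m - 2 ≤ ∑ j ∈ Finset.range (n + 1), teleMin m j := by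
  have hn' : (0 : ℝ) < n := by exact_mod_cast hn
  unfold teleMin
  rw [Finset.sum_sub_distrib, ← Finset.mul_sum,
    Finset.sum_range_sub (fun j : ℕ => Real.log (j + m)),
    Finset.sum_range_sub' (fun j : ℕ => 1 / ((j : ℝ) + m - 1))]
  push_cast
  have h1 : Real.log n ≤ Real.log ((n : ℝ) + 1 + m) := Real.log_le_log hn' (by linarith)
  have h2 : m * (1 / ((0 : ℝ) + m - 1)) ≤ 2 := by
    rw [mul_one_div, div_le_iff₀ (by linarith)]; linarith
  have h3 : 0 ≤ m * (1 / ((n : ℝ) + 1 + m - 1)) := by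
    apply mul_nonneg (by linarith)
    apply one_div_nonneg.2; linarith
  rw [mul_sub, zero_add] at *
  linarith

lemma norm_add_le_mul_exp {a δ v : ℝ} (ha : 0 < a) (hδ : 0 ≤ δ) (h : a + δ ≤ 1) (j : ℕ) :
    ‖(a + v * I : ℂ) + j‖ ≤
      ‖((a + δ : ℝ) + v * I : ℂ) + j‖ * Real.exp (-(δ * teleMin (2 + |v|) j)) := by
  have hj : (0 : ℝ) ≤ j := j.cast_nonneg
  have hv := abs_nonneg v
  have hd := teleMin_le (m := 2 + |v|) (by linarith) j
  set d := teleMin (2 + |v|) j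
  set m := 2 + |v| with hm
  refine le_of_sq_le_sq ?_ (by positivity)
  rw [mul_pow, ← Complex.normSq_eq_norm_sq, ← Complex.normSq_eq_norm_sq, ← Real.exp_nat_mul,
    Complex.normSq_apply, Complex.normSq_apply]
  simp
  have hv2 : v * v = |v| * |v| := (abs_mul_abs_self v).symm
  have hD : (a + δ + j) * (a + δ + j) + v * v ≤ (j + m) ^ 2 := by
    rw [hv2, hm]; nlinarith
  have hD0 : 0 ≤ (a + δ + j) * (a + δ + j) + v * v :=
    add_nonneg (mul_self_nonneg _) (mul_self_nonneg _)
  have hjm : (j : ℝ) + m ≠ 0 := by positivity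
  have hDd : ((a + δ + j) * (a + δ + j) + v * v) * d ≤ j := by
    calc _ ≤ ((a + δ + j) * (a + δ + j) + v * v) * (j / (j + m) ^ 2) := by gcongr
      _ ≤ (j + m) ^ 2 * (j / (j + m) ^ 2) := by gcongr
      _ = j := mul_div_cancel₀ _ (pow_ne_zero 2 hjm)
  have he := Real.add_one_le_exp (-(2 * (δ * d)))
  have he2 := mul_le_mul_of_nonneg_left he hD0
  nlinarith [mul_le_mul_of_nonneg_left hDd hδ]

lemma norm_Gamma_add_le {a δ : ℝ} (ha : 0 < a) (hδ : 0 ≤ δ) (h : a + δ ≤ 1) (v : ℝ) :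
    ‖Complex.Gamma ((a + δ : ℝ) + v * I)‖ ≤
      Real.exp (δ * (Real.log (2 + |v|) + 2)) * ‖Complex.Gamma (a + v * I)‖ := by
  have hv := abs_nonneg v
  have t1 := (Complex.GammaSeq_tendsto_Gamma ((a + δ : ℝ) + v * I)).norm
  have t2 := (Complex.GammaSeq_tendsto_Gamma (a + v * I)).norm.const_mul
    (Real.exp (δ * (Real.log (2 + |v|) + 2)))
  refine le_of_tendsto_of_tendsto t1 t2 ?_
  filter_upwards [Filter.eventually_gt_atTop 0] with n hn
  have hn' : (0 : ℝ) < n := by exact_mod_cast hn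
  have hn'' : (n : ℂ) = ((n : ℝ) : ℂ) := by push_cast; rfl
  have hpos : ∀ b : ℝ, 0 < b → ∀ j : ℕ, 0 < ‖(b + v * I : ℂ) + j‖ := fun b hb j => by
    rw [norm_pos_iff]
    intro h0
    have := congrArg Complex.re h0
    simp at this
    have hj : (0 : ℝ) ≤ j := j.cast_nonneg
    linarith
  have hprod : ∏ j ∈ Finset.range (n + 1), ‖(a + v * I : ℂ) + j‖ ≤
      (∏ j ∈ Finset.range (n + 1), ‖((a + δ : ℝ) + v * I : ℂ) + j‖) *
        Real.exp (-(δ * (Real.log n - Real.log (2 + |v|) - 2))) := by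
    calc _ ≤ ∏ j ∈ Finset.range (n + 1), (‖((a + δ : ℝ) + v * I : ℂ) + j‖ *
          Real.exp (-(δ * teleMin (2 + |v|) j))) :=
          Finset.prod_le_prod (fun j _ => norm_nonneg _)
            fun j _ => norm_add_le_mul_exp ha hδ h j
      _ ≤ _ := by
          rw [Finset.prod_mul_distrib, ← Real.exp_sum, Finset.sum_neg_distrib, ← Finset.mul_sum]
          have := le_sum_teleMin (m := 2 + |v|) (by linarith) hn
          gcongr
  rw [Complex.GammaSeq, Complex.GammaSeq, norm_div, norm_div, norm_mul, norm_mul, norm_prod,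
    norm_prod, hn'', Complex.norm_cpow_eq_rpow_re_of_pos hn',
    Complex.norm_cpow_eq_rpow_re_of_pos hn']
  have e1 : ((a + δ : ℝ) + v * I : ℂ).re = a + δ := by simp
  have e2 : (a + v * I : ℂ).re = a := by simp
  rw [e1, e2]
  set P := ∏ j ∈ Finset.range (n + 1), ‖(a + v * I : ℂ) + j‖ with hP
  set Q := ∏ j ∈ Finset.range (n + 1), ‖((a + δ : ℝ) + v * I : ℂ) + j‖ with hQ
  have hP0 : 0 < P := Finset.prod_pos fun j _ => hpos a ha j
  have hQ0 : 0 < Q := Finset.prod_pos fun j _ => hpos (a + δ) (by linarith) j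
  set F := ‖((Nat.factorial n : ℕ) : ℂ)‖ with hF
  have hF0 : 0 ≤ F := norm_nonneg _
  rw [← mul_div_assoc, div_le_div_iff₀ hQ0 hP0, Real.rpow_add hn']
  have e3 : (n : ℝ) ^ δ * Real.exp (-(δ * (Real.log n - Real.log (2 + |v|) - 2))) =
      Real.exp (δ * (Real.log (2 + |v|) + 2)) := by
    rw [Real.rpow_def_of_pos hn', ← Real.exp_add]
    congr 1; ring
  rw [← e3]
  calc (n : ℝ) ^ a * n ^ δ * F * P ≤ (n : ℝ) ^ a * n ^ δ * F *
        (Q * Real.exp (-(δ * (Real.log n - Real.log (2 + |v|) - 2)))) := by gcongr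
    _ = _ := by ring

lemma norm_riemannZeta₁ {s : ℂ} (hs : s ≠ 1) : ‖riemannZeta₁ s‖ = ‖s - 1‖ * ‖riemannZeta s‖ := by
  rw [riemannZeta_eq_inv_sub_mul hs, norm_mul, norm_inv,
    mul_inv_cancel_left₀ (norm_ne_zero_iff.2 (sub_ne_zero.2 hs))]

lemma norm_riemannZeta_reflect {δ : ℝ} (hδ : 0 < δ) (hδ' : δ ≤ 1 / 4) (u : ℝ) :
    ‖riemannZeta ((1 / 2 - δ : ℝ) + u * I)‖ ≤
      ‖riemannZeta ((1 / 2 + δ : ℝ) + u * I)‖ * Real.exp (δ * (2 + Real.log (2 + |u|))) := by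
  have hu := abs_nonneg u
  set s : ℂ := (1 / 2 - δ : ℝ) + u * I with hs
  set s' : ℂ := (1 / 2 + δ : ℝ) + u * I with hs'
  have hc : 1 - s = (starRingEnd ℂ) s' := by
    rw [hs, hs']
    apply Complex.ext <;> simp
    ring
  have hre : s.re = 1 / 2 - δ := by simp [hs]
  have hre' : s'.re = 1 / 2 + δ := by simp [hs']
  have h0 : s ≠ 0 := by intro h; rw [h] at hre; simp at hre; linarith
  have h0' : 1 - s ≠ 0 := by
    intro h
    have := congrArg Complex.re h
    simp [hre] at this
    linarith
  have hz : ‖riemannZeta s'‖ = ‖riemannZeta (1 - s)‖ := by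
    rw [hc, riemannZeta_conj, RCLike.norm_conj]
  have hG : ‖Gammaℝ (1 - s)‖ = ‖Gammaℝ s'‖ := by
    rw [hc, Gammaℝ_def, Gammaℝ_def, norm_mul, norm_mul]
    rw [Complex.norm_cpow_eq_rpow_re_of_pos Real.pi_pos,
      Complex.norm_cpow_eq_rpow_re_of_pos Real.pi_pos]
    have : (starRingEnd ℂ) s' / 2 = (starRingEnd ℂ) (s' / 2) := by
      rw [map_div₀, map_ofNat]
    rw [this, Complex.Gamma_conj, RCLike.norm_conj]
    simp
  have hGs : Gammaℝ s ≠ 0 := Gammaℝ_ne_zero_of_re_pos (by rw [hre]; linarith)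
  have hGs' : Gammaℝ (1 - s) ≠ 0 := Gammaℝ_ne_zero_of_re_pos (by simp [hre]; linarith)
  have hfe : ‖riemannZeta s‖ * ‖Gammaℝ s‖ = ‖riemannZeta s'‖ * ‖Gammaℝ s'‖ := by
    rw [hz, ← hG, riemannZeta_def_of_ne_zero h0, riemannZeta_def_of_ne_zero h0',
      completedRiemannZeta_one_sub, norm_div, norm_div, div_mul_cancel₀ _ (norm_ne_zero_iff.2 hGs),
      div_mul_cancel₀ _ (norm_ne_zero_iff.2 hGs')]
  have hgam : ‖Gammaℝ s'‖ ≤ Real.exp (δ * (2 + Real.log (2 + |u|))) * ‖Gammaℝ s‖ := by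
    have hg := norm_Gamma_add_le (a := 1 / 4 - δ / 2) (δ := δ) (by linarith) hδ.le
      (by linarith) (u / 2)
    have e1 : (((1 / 4 - δ / 2 + δ : ℝ) : ℂ) + (u / 2 : ℝ) * I) = s' / 2 := by
      rw [hs']; push_cast; ring
    have e2 : (((1 / 4 - δ / 2 : ℝ) : ℂ) + (u / 2 : ℝ) * I) = s / 2 := by
      rw [hs]; push_cast; ring
    rw [e1, e2] at hg
    rw [Gammaℝ_def, Gammaℝ_def, norm_mul, norm_mul,
      Complex.norm_cpow_eq_rpow_re_of_pos Real.pi_pos,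
      Complex.norm_cpow_eq_rpow_re_of_pos Real.pi_pos]
    have hp : π ^ (-s' / 2).re ≤ π ^ (-s / 2).re := by
      apply Real.rpow_le_rpow_of_exponent_le (by linarith [Real.pi_gt_three])
      simp [hre, hre']
      linarith
    have hl : Real.log (2 + |u / 2|) ≤ Real.log (2 + |u|) := by
      apply Real.log_le_log (by positivity)
      rw [abs_div, abs_two]
      linarith
    calc _ ≤ π ^ (-s / 2).re * (Real.exp (δ * (Real.log (2 + |u / 2|) + 2)) *
          ‖Complex.Gamma (s / 2)‖) := by gcongr
      _ ≤ π ^ (-s / 2).re * (Real.exp (δ * (2 + Real.log (2 + |u|))) *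
          ‖Complex.Gamma (s / 2)‖) := by gcongr _ * (Real.exp (_ * ?_) * _); linarith
      _ = _ := by ring
  have hGp : 0 < ‖Gammaℝ s‖ := norm_pos_iff.2 hGs
  rw [← mul_le_mul_iff_left₀ hGp, hfe]
  calc _ ≤ ‖riemannZeta s'‖ * (Real.exp (δ * (2 + Real.log (2 + |u|))) * ‖Gammaℝ s‖) := by gcongr
    _ = _ := by ring

/-- Comparison of `(s - 1) ζ(s)` at points symmetric about the critical line. -/
lemma norm_riemannZeta₁_reflect {δ : ℝ} (hδ : 0 < δ) (hδ' : δ ≤ 1 / 4) (u : ℝ) :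
    ‖riemannZeta₁ ((1 / 2 - δ : ℝ) + u * I)‖ ≤
      ‖riemannZeta₁ ((1 / 2 + δ : ℝ) + u * I)‖ * Real.exp (δ * (18 + Real.log (2 + |u|))) := by
  have n1 : ((1 / 2 - δ : ℝ) + u * I : ℂ) ≠ 1 := by
    intro h; have := congrArg Complex.re h; simp at this; linarith
  have n2 : ((1 / 2 + δ : ℝ) + u * I : ℂ) ≠ 1 := by
    intro h; have := congrArg Complex.re h; simp at this; linarith
  rw [norm_riemannZeta₁ n1, norm_riemannZeta₁ n2]
  have h1 : ‖((1 / 2 - δ : ℝ) + u * I : ℂ) - 1‖ ≤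
      ‖((1 / 2 + δ : ℝ) + u * I : ℂ) - 1‖ * Real.exp (δ * 16) := by
    refine le_of_sq_le_sq ?_ (by positivity)
    rw [mul_pow, ← Complex.normSq_eq_norm_sq, ← Complex.normSq_eq_norm_sq, ← Real.exp_nat_mul,
      Complex.normSq_apply, Complex.normSq_apply]
    simp only [sub_re, add_re, ofReal_re, mul_re, I_re, mul_zero, ofReal_im, I_im, mul_one,
      sub_self, add_zero, one_re, sub_im, add_im, mul_im, one_im, zero_add, sub_zero]
    have he := Real.add_one_le_exp (((2 : ℕ) : ℝ) * (δ * 16))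
    push_cast at he ⊢
    have : 0 ≤ (1 / 2 + δ - 1) * (1 / 2 + δ - 1) + u * u :=
      add_nonneg (mul_self_nonneg _) (mul_self_nonneg _)
    have h3 := mul_le_mul_of_nonneg_left he this
    refine le_trans ?_ h3
    have h4 : 1 / 16 ≤ (1 / 2 + δ - 1) * (1 / 2 + δ - 1) := by nlinarith
    nlinarith [mul_self_nonneg u]
  calc _ ≤ (‖((1 / 2 + δ : ℝ) + u * I : ℂ) - 1‖ * Real.exp (δ * 16)) *
        (‖riemannZeta ((1 / 2 + δ : ℝ) + u * I)‖ * Real.exp (δ * (2 + Real.log (2 + |u|)))) := by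
        gcongr
        exact norm_riemannZeta_reflect hδ hδ' u
    _ = ‖((1 / 2 + δ : ℝ) + u * I : ℂ) - 1‖ * ‖riemannZeta ((1 / 2 + δ : ℝ) + u * I)‖ *
        (Real.exp (δ * 16) * Real.exp (δ * (2 + Real.log (2 + |u|)))) := by ring
    _ = _ := by
      rw [← Real.exp_add]
      congr 2; ring

/-- A nonvanishing holomorphic function on a disc has a holomorphic logarithm. -/
lemma exists_eq_mul_exp_on_ball {f : ℂ → ℂ} {R : ℝ} (hR : 0 < R) (hf : Differentiable ℂ f)
    (h0 : ∀ z ∈ Metric.ball (0 : ℂ) R, f z ≠ 0) :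
    ∃ F : ℂ → ℂ, DifferentiableOn ℂ F (Metric.ball 0 R) ∧ F 0 = 0 ∧
      ∀ z ∈ Metric.ball (0 : ℂ) R, f z = f 0 * Complex.exp (F z) := by
  have hd : DifferentiableOn ℂ (fun z => deriv f z / f z) (Metric.ball 0 R) := fun z hz =>
    ((hf.contDiff (n := 2)).differentiable_deriv_two z).div (hf z) (h0 z hz) |>.differentiableWithinAt
  obtain ⟨F, hF0, hF⟩ := hd.isExactOn_ball.with_val_at 0 0
  refine ⟨F, fun z hz => (hF z hz).differentiableAt.differentiableWithinAt, hF0, ?_⟩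
  set q : ℂ → ℂ := fun z => f z * Complex.exp (-F z) with hq
  have hqd : ∀ z ∈ Metric.ball (0 : ℂ) R, HasDerivAt q 0 z := by
    intro z hz
    have hne := h0 z hz
    have h1 : deriv f z * Complex.exp ((-F) z) +
        f z * (Complex.exp ((-F) z) * -(deriv f z / f z)) = 0 := by
      field_simp; ring
    have h2 := (hf z).hasDerivAt.mul ((hF z hz).neg.cexp)
    rw [h1] at h2
    exact h2
  intro z hz
  have hc : q z = q 0 := by
    refine (convex_ball (0 : ℂ) R).is_const_of_fderivWithin_eq_zero (𝕜 := ℂ)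
      (fun w hw => (hqd w hw).differentiableAt.differentiableWithinAt) ?_ hz
      (Metric.mem_ball_self hR)
    intro w hw
    rw [fderivWithin_of_isOpen Metric.isOpen_ball hw]
    have := (hqd w hw).hasFDerivAt.fderiv
    rw [this]; simp
  simp only [hq, hF0, neg_zero, Complex.exp_zero, mul_one] at hc
  rw [← hc, mul_assoc, ← Complex.exp_add]
  simp

lemma norm_riemannZeta_sub_one_le {s : ℂ} (hs : 2 ≤ s.re) : ‖riemannZeta s - 1‖ ≤ 3 / 4 := by
  have h1 : 1 < s.re := by linarith
  have hsum : Summable fun n : ℕ => 1 / (n + 1 : ℂ) ^ s := by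
    have := (summable_nat_add_iff 1).2 (Complex.summable_one_div_nat_cpow.2 h1)
    exact_mod_cast this
  have h2 : HasSum (fun n : ℕ => (1 : ℝ) / ((n : ℝ) + 2) ^ 2) (π ^ 2 / 6 - 1) := by
    have := (hasSum_nat_add_iff' (f := fun n : ℕ => (1 : ℝ) / (n : ℝ) ^ 2) 2).2 hasSum_zeta_two
    simp [Finset.sum_range_succ] at this
    simpa using this
  rw [zeta_eq_tsum_one_div_nat_add_one_cpow h1, hsum.tsum_eq_zero_add]
  simp only [Nat.cast_zero, zero_add, one_cpow, div_one, add_sub_cancel_left]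
  have hb : ∀ n : ℕ, ‖1 / (((n + 1 : ℕ) : ℂ) + 1) ^ s‖ ≤ (1 : ℝ) / ((n : ℝ) + 2) ^ 2 := by
    intro n
    have : (((n + 1 : ℕ) : ℂ) + 1) = ((n + 2 : ℝ) : ℂ) := by push_cast; ring
    rw [this, norm_div, norm_one, Complex.norm_cpow_eq_rpow_re_of_pos (by positivity)]
    gcongr
    rw [← Real.rpow_natCast]
    exact Real.rpow_le_rpow_of_exponent_le (by linarith [n.cast_nonneg (α := ℝ)]) (by simpa)
  refine (tsum_of_norm_bounded h2 hb).trans ?_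
  have := Real.pi_lt_d2
  have := Real.pi_pos
  nlinarith

lemma riemannZeta₁_ne_zero (hRH : RiemannHypothesis) {s : ℂ} (hs : 1 / 2 < s.re) :
    riemannZeta₁ s ≠ 0 := by
  by_cases h : s = 1
  · rw [h, riemannZeta₁_one]; exact one_ne_zero
  intro h0
  have hz : riemannZeta s = 0 := by rw [riemannZeta_eq_inv_sub_mul h, h0, mul_zero]
  have := hRH s hz ?_ h
  · linarith
  · rintro ⟨n, rfl⟩
    have : (0 : ℝ) ≤ n := n.cast_nonneg
    simp at hs
    linarith

lemma le_norm_riemannZeta₁ {s : ℂ} (hs : 2 ≤ s.re) : 1 / 4 ≤ ‖riemannZeta₁ s‖ := by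
  have h1 : s ≠ 1 := by rintro rfl; norm_num at hs
  rw [norm_riemannZeta₁ h1]
  have ha : 1 ≤ ‖s - 1‖ := by
    have := Complex.re_le_norm (s - 1)
    simp at this; linarith
  have hb : 1 / 4 ≤ ‖riemannZeta s‖ := by
    have := norm_riemannZeta_sub_one_le hs
    have h3 := norm_sub_norm_le (1 : ℂ) (riemannZeta s)
    rw [norm_sub_rev, norm_one] at h3
    linarith
  nlinarith

lemma norm_inv_riemannZeta₁_le (hRH : RiemannHypothesis) {δ : ℝ} (hδ : 0 < δ) (hδ' : δ ≤ 1) {s : ℂ}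
    (hs : 1 / 2 + δ ≤ s.re) : ‖(riemannZeta₁ s)⁻¹‖ ≤ Real.exp (200 / δ * (1 + ‖s‖)) := by
  have hns := norm_nonneg s
  have h4 : (4 : ℝ) ≤ Real.exp (200 / 4 * (1 + ‖s‖)) := by
    have := Real.add_one_le_exp (200 / 4 * (1 + ‖s‖)); linarith
  rcases le_or_gt 2 s.re with h2 | h2
  · rw [norm_inv]
    have := le_norm_riemannZeta₁ h2
    calc _ ≤ (1 / 4 : ℝ)⁻¹ := by gcongr
      _ = 4 := by norm_num
      _ ≤ _ := h4
      _ ≤ _ := by gcongr; linarith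
  set c : ℂ := ⟨2, s.im⟩ with hc
  have hcs : s = c + ((s.re - 2 : ℝ) : ℂ) := by apply Complex.ext <;> simp [hc]
  have hcn : ‖c‖ ≤ 2 + ‖s‖ := by
    have := Complex.norm_le_abs_re_add_abs_im c
    have h3 := Complex.abs_im_le_norm s
    simp [hc] at this
    linarith
  have hc4 := le_norm_riemannZeta₁ (s := c) (by simp [hc])
  set f : ℂ → ℂ := fun z => riemannZeta₁ (c + z) with hf
  have hfd : Differentiable ℂ f := by
    intro z
    have := differentiable_riemannZeta₁
    fun_prop
  have hre : ∀ z ∈ Metric.ball (0 : ℂ) (3 / 2), 1 / 2 < (c + z).re := by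
    intro z hz
    rw [mem_ball_zero_iff] at hz
    have := (abs_le.1 ((Complex.abs_re_le_norm z))).1
    simp [hc]; linarith
  obtain ⟨F, hFd, hF0, hF⟩ := exists_eq_mul_exp_on_ball (R := 3 / 2) (by norm_num) hfd
    (fun z hz => riemannZeta₁_ne_zero hRH (hre z hz))
  have hM : ∀ z ∈ Metric.ball (0 : ℂ) (3 / 2), (F z).re ≤ 20 + 2 * ‖s‖ + 20 := by
    intro z hz
    have h1 := hF z hz
    have h2 : ‖f z‖ ≤ 5 * (1 + (2 + ‖s‖ + 3 / 2)) ^ 2 := by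
      refine (norm_riemannZeta₁_le (by linarith [hre z hz])).trans ?_
      rw [mem_ball_zero_iff] at hz
      gcongr
      exact (norm_add_le _ _).trans (by linarith)
    rw [h1, norm_mul, Complex.norm_exp] at h2
    have h3 : 1 / 4 ≤ ‖f 0‖ := by simpa [hf] using hc4
    have h4 : Real.exp (F z).re ≤ 20 * (1 + (2 + ‖s‖ + 3 / 2)) ^ 2 := by
      have := Real.exp_pos (F z).re
      nlinarith
    rw [← Real.exp_le_exp]
    refine h4.trans ?_
    have h20 : (20 : ℝ) ≤ Real.exp 20 := by
      have := Real.add_one_le_exp (20 : ℝ); linarith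
    have h9 : (1 + (2 + ‖s‖ + 3 / 2)) ≤ Real.exp (‖s‖ + 10) := by
      have := Real.add_one_le_exp (‖s‖ + 10); linarith
    calc _ ≤ Real.exp 20 * (Real.exp (‖s‖ + 10)) ^ 2 := by gcongr
      _ = _ := by rw [← Real.exp_nat_mul, ← Real.exp_add]; congr 1; push_cast; ring
  have hz : ((s.re - 2 : ℝ) : ℂ) ∈ Metric.ball (0 : ℂ) (3 / 2) := by
    rw [mem_ball_zero_iff, Complex.norm_real, Real.norm_eq_abs, abs_lt]; constructor <;> linarith
  have hzn : ‖((s.re - 2 : ℝ) : ℂ)‖ ≤ 3 / 2 - δ := by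
    rw [Complex.norm_real, Real.norm_eq_abs, abs_le]; constructor <;> linarith
  have hBC := Complex.borelCaratheodory (M := 20 + 2 * ‖s‖ + 20) (by positivity) hFd hM
    (by norm_num) hz
  rw [hF0, norm_zero, zero_mul, zero_div, add_zero] at hBC
  set z := ((s.re - 2 : ℝ) : ℂ) with hzdef
  have hBC2 : ‖F z‖ ≤ 2 * (20 + 2 * ‖s‖ + 20) * (3 / 2) / δ := by
    refine hBC.trans ?_
    gcongr <;> linarith
  have hval : riemannZeta₁ s = riemannZeta₁ c * Complex.exp (F z) := by
    have := hF z hz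
    simp only [hf, add_zero] at this
    rw [← this, ← hcs]
  rw [hval, mul_inv, norm_mul, norm_inv, ← Complex.exp_neg, Complex.norm_exp]
  have h5 : (-F z).re ≤ 2 * (20 + 2 * ‖s‖ + 20) * (3 / 2) / δ :=
    (Complex.re_le_norm _).trans (by rwa [norm_neg])
  have h6 : ‖riemannZeta₁ c‖⁻¹ ≤ Real.exp 4 := by
    have : (4 : ℝ) ≤ Real.exp 4 := by
      have := Real.add_one_le_exp (4 : ℝ); linarith
    calc _ ≤ (1 / 4 : ℝ)⁻¹ := by gcongr
      _ = 4 := by norm_num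
      _ ≤ _ := this
  calc _ ≤ Real.exp 4 * Real.exp (2 * (20 + 2 * ‖s‖ + 20) * (3 / 2) / δ) := by gcongr
    _ = Real.exp (4 + 2 * (20 + 2 * ‖s‖ + 20) * (3 / 2) / δ) := by rw [Real.exp_add]
    _ ≤ _ := by
      gcongr
      have h7 : (4 : ℝ) ≤ 4 / δ := by rw [le_div_iff₀ hδ]; linarith
      calc _ ≤ 4 / δ + 2 * (20 + 2 * ‖s‖ + 20) * (3 / 2) / δ := by gcongr
        _ = (124 + 6 * ‖s‖) / δ := by ring
        _ ≤ (200 * (1 + ‖s‖)) / δ := by gcongr; linarith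
        _ = _ := by ring

/-- The quotient to which the Phragmén–Lindelöf principle is applied. -/
noncomputable def zetaQuot (δ : ℝ) (s : ℂ) : ℂ :=
  riemannZeta₁ (1 / 2 - δ + s) * (riemannZeta₁ (1 / 2 + δ + s))⁻¹ *
    Complex.exp (-(δ * (Complex.log (s + 2) + 19)))

lemma norm_exp_log_le {δ : ℝ} (s : ℂ) :
    ‖Complex.exp (-(δ * (Complex.log (s + 2) + 19)))‖ = Real.exp (-(δ * (Real.log ‖s + 2‖ + 19))) := by
  rw [Complex.norm_exp]
  simp [Complex.log_re]

lemma norm_exp_log_le_one {δ : ℝ} (hδ : 0 < δ) {s : ℂ} (hs : 0 ≤ s.re) :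
    ‖Complex.exp (-(δ * (Complex.log (s + 2) + 19)))‖ ≤ 1 := by
  rw [norm_exp_log_le]
  have : 0 ≤ Real.log ‖s + 2‖ := by
    apply Real.log_nonneg
    have := Complex.re_le_norm (s + 2)
    simp at this; linarith
  rw [Real.exp_le_one_iff]
  have : 0 ≤ δ * (Real.log ‖s + 2‖ + 19) := by positivity
  linarith

lemma norm_zetaQuot_le (hRH : RiemannHypothesis) {δ : ℝ} (hδ : 0 < δ) (hδ' : δ ≤ 1 / 4) {s : ℂ}
    (hs : 0 ≤ s.re) : ‖zetaQuot δ s‖ ≤ 1 := by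
  refine PhragmenLindelof.right_half_plane_of_bounded_on_real (f := zetaQuot δ) ?_ ?_ ?_ ?_ hs
  · refine DifferentiableOn.diffContOnCl ?_
    intro z hz
    have hz' : 0 ≤ z.re := by
      rw [Complex.closure_setOfPred_lt_re] at hz
      exact hz
    apply DifferentiableAt.differentiableWithinAt
    have h1 : riemannZeta₁ (1 / 2 + δ + z) ≠ 0 := by
      refine riemannZeta₁_ne_zero hRH ?_
      simp; linarith
    have h2 : z + 2 ∈ slitPlane := by left; simp; linarith
    have hd := differentiable_riemannZeta₁
    unfold zetaQuot
    fun_prop (disch := assumption)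
  · refine ⟨1, by norm_num, 200 / δ + 2, ?_⟩
    refine Asymptotics.IsBigO.of_bound (5 * Real.exp (2 + 400 / δ)) ?_
    filter_upwards [Filter.mem_inf_of_right (Filter.mem_principal_self _)] with z hz
    have hz' : 0 ≤ z.re := le_of_lt hz
    have h1 : ‖riemannZeta₁ (1 / 2 - δ + z)‖ ≤ 5 * Real.exp (1 + ‖z‖) ^ 2 := by
      refine (norm_riemannZeta₁_le (by simp; linarith)).trans ?_
      have h2 : ‖(1 / 2 - δ + z : ℂ)‖ ≤ 1 + ‖z‖ := by
        refine (norm_add_le _ _).trans ?_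
        gcongr
        have : (1 / 2 - δ : ℂ) = ((1 / 2 - δ : ℝ) : ℂ) := by push_cast; ring
        rw [this, Complex.norm_real, Real.norm_eq_abs, abs_le]
        constructor <;> linarith
      have := Real.add_one_le_exp (1 + ‖z‖)
      gcongr
      linarith
    have h3 : ‖(riemannZeta₁ (1 / 2 + δ + z))⁻¹‖ ≤ Real.exp (200 / δ * (2 + ‖z‖)) := by
      refine (norm_inv_riemannZeta₁_le hRH hδ (by linarith) (by simp; linarith)).trans ?_
      have h2 : ‖(1 / 2 + δ + z : ℂ)‖ ≤ 1 + ‖z‖ := by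
        refine (norm_add_le _ _).trans ?_
        gcongr
        have : (1 / 2 + δ : ℂ) = ((1 / 2 + δ : ℝ) : ℂ) := by push_cast; ring
        rw [this, Complex.norm_real, Real.norm_eq_abs, abs_le]
        constructor <;> linarith
      have h4 : 1 + ‖(1 / 2 + δ + z : ℂ)‖ ≤ 2 + ‖z‖ := by linarith
      gcongr
    rw [zetaQuot, norm_mul, norm_mul, Real.norm_of_nonneg (Real.exp_pos _).le, Real.rpow_one]
    calc _ ≤ 5 * Real.exp (1 + ‖z‖) ^ 2 * Real.exp (200 / δ * (2 + ‖z‖)) * 1 := by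
          gcongr
          exact norm_exp_log_le_one hδ hz'
      _ = _ := by
          rw [mul_one, mul_assoc, mul_assoc, ← Real.exp_nat_mul, ← Real.exp_add, ← Real.exp_add]
          congr 2
          push_cast
          ring
  · refine ⟨100, ?_⟩
    rw [Filter.eventually_map]
    filter_upwards [Filter.eventually_ge_atTop 2] with x hx
    rw [zetaQuot, norm_mul, norm_mul, norm_inv]
    have e1 : (1 / 2 - δ + x : ℂ) = ((1 / 2 - δ + x : ℝ) : ℂ) := by push_cast; ring
    have e2 : (1 / 2 + δ + x : ℂ) = ((1 / 2 + δ + x : ℝ) : ℂ) := by push_cast; ring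
    have hz : ∀ y : ℝ, 2 ≤ y → ‖riemannZeta₁ y‖ = (y - 1) * ‖riemannZeta y‖ ∧
        1 / 4 ≤ ‖riemannZeta y‖ ∧ ‖riemannZeta y‖ ≤ 7 / 4 := by
      intro y hy
      have h1 : (y : ℂ) ≠ 1 := by
        intro h
        have : y = 1 := by exact_mod_cast h
        linarith
      have h2 : ‖(y : ℂ) - 1‖ = y - 1 := by
        rw [← Complex.ofReal_one, ← Complex.ofReal_sub, Complex.norm_real]
        exact Real.norm_of_nonneg (by linarith)
      have h3 := norm_riemannZeta_sub_one_le (s := y) (by simpa)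
      have h4 := abs_norm_sub_norm_le (riemannZeta y) 1
      rw [norm_one] at h4
      have h5 := abs_le.1 (h4.trans h3)
      refine ⟨by rw [norm_riemannZeta₁ h1, h2], by linarith, by linarith⟩
    obtain ⟨a1, a2, a3⟩ := hz (1 / 2 - δ + x) (by linarith)
    obtain ⟨b1, b2, b3⟩ := hz (1 / 2 + δ + x) (by linarith)
    rw [e1, e2, a1, b1]
    have hpos : 0 < (1 / 2 + δ + x - 1) * ‖riemannZeta (1 / 2 + δ + x : ℝ)‖ := by
      apply mul_pos <;> linarith
    calc _ ≤ (1 / 2 - δ + x - 1) * ‖riemannZeta (1 / 2 - δ + x : ℝ)‖ *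
          ((1 / 2 + δ + x - 1) * ‖riemannZeta (1 / 2 + δ + x : ℝ)‖)⁻¹ * 1 := by
            gcongr
            · have : 0 ≤ 1 / 2 - δ + x - 1 := by linarith
              positivity
            · exact norm_exp_log_le_one hδ (by simp; linarith)
      _ ≤ 100 := by
        rw [mul_one, ← div_eq_mul_inv, div_le_iff₀ hpos]
        nlinarith
  · intro u
    rw [zetaQuot, norm_mul, norm_mul, norm_inv, norm_exp_log_le]
    have h1 := norm_riemannZeta₁_reflect hδ hδ' u
    have e1 : (1 / 2 - δ + u * I : ℂ) = ((1 / 2 - δ : ℝ) : ℂ) + u * I := by push_cast; ring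
    have e2 : (1 / 2 + δ + u * I : ℂ) = ((1 / 2 + δ : ℝ) : ℂ) + u * I := by push_cast; ring
    rw [e1, e2]
    have hpos : 0 < ‖riemannZeta₁ (((1 / 2 + δ : ℝ) : ℂ) + u * I)‖ :=
      norm_pos_iff.2 (riemannZeta₁_ne_zero hRH (by simp; linarith))
    have h2 : Real.log (2 + |u|) ≤ Real.log ‖(u * I + 2 : ℂ)‖ + 1 := by
      have h3 := Complex.abs_re_le_norm (u * I + 2 : ℂ)
      have h4 := Complex.abs_im_le_norm (u * I + 2 : ℂ)
      simp at h3 h4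
      have h5 : 2 + |u| ≤ 2 * ‖(u * I + 2 : ℂ)‖ := by linarith
      have hu := abs_nonneg u
      have h6 := Real.log_le_log (by linarith) h5
      rw [Real.log_mul (by norm_num) (by linarith)] at h6
      have := Real.log_two_lt_d9
      linarith
    calc _ ≤ ‖riemannZeta₁ (((1 / 2 + δ : ℝ) : ℂ) + u * I)‖ *
          Real.exp (δ * (18 + Real.log (2 + |u|))) *
          ‖riemannZeta₁ (((1 / 2 + δ : ℝ) : ℂ) + u * I)‖⁻¹ *
          Real.exp (-(δ * (Real.log ‖(u * I + 2 : ℂ)‖ + 19))) := by gcongr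
      _ = Real.exp (δ * (18 + Real.log (2 + |u|)) - δ * (Real.log ‖(u * I + 2 : ℂ)‖ + 19)) := by
          rw [sub_eq_add_neg, Real.exp_add, mul_right_comm _ _ (_⁻¹), mul_inv_cancel₀ hpos.ne', one_mul]
      _ ≤ 1 := by
          rw [Real.exp_le_one_iff]
          nlinarith

lemma hasDerivAt_nonpos_of_le {f : ℝ → ℝ} {f' η : ℝ} (hη : 0 < η) (hf : HasDerivAt f f' 0)
    (h : ∀ x, 0 < x → x ≤ η → f x ≤ f 0) : f' ≤ 0 := by
  have h1 := hf.hasDerivWithinAt (s := Set.Ioi 0)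
  rw [hasDerivWithinAt_iff_tendsto_slope' (by simp)] at h1
  refine le_of_tendsto h1 ?_
  filter_upwards [Ioc_mem_nhdsGT hη] with x hx
  rw [slope_def_field]
  exact div_nonpos_of_nonpos_of_nonneg (by linarith [h x hx.1 hx.2]) (by linarith [hx.1])

/-- Under the Riemann hypothesis, a lower bound for the real part of `ζ₁'/ζ₁` to the right of the
critical line. -/
lemma neg_log_le_re_logDeriv (hRH : RiemannHypothesis) {s : ℂ} (hs : 0 < s.re) :
    -(1 / 2 * Real.log ‖s + 2‖ + 10) ≤
      (deriv riemannZeta₁ (1 / 2 + s) / riemannZeta₁ (1 / 2 + s)).re := by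
  set w : ℂ := 1 / 2 + s with hw
  have hne : riemannZeta₁ w ≠ 0 := riemannZeta₁_ne_zero hRH (by simp [hw, hs])
  set K : ℂ := Complex.log (s + 2) + 19 with hK
  have hZ := (differentiable_riemannZeta₁ w).hasDerivAt
  set D := deriv riemannZeta₁ w
  have hq : HasDerivAt (fun z : ℂ => riemannZeta₁ (w - z) * (riemannZeta₁ (w + z))⁻¹ *
      Complex.exp (-(z * K))) (-(2 * (D / riemannZeta₁ w) + K)) 0 := by
    have h1 : HasDerivAt (fun z : ℂ => riemannZeta₁ (w - z)) (-D) 0 := by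
      have := HasDerivAt.comp_const_sub (f := riemannZeta₁) (f' := D) w 0 (by simpa using hZ)
      exact this
    have h2 : HasDerivAt (fun z : ℂ => riemannZeta₁ (w + z)) D 0 :=
      HasDerivAt.comp_const_add (f := riemannZeta₁) (f' := D) w 0 (by simpa using hZ)
    have h3 : HasDerivAt (fun z : ℂ => Complex.exp (-(z * K)))
        (Complex.exp (-(0 * K)) * -(1 * K)) 0 :=
      (((hasDerivAt_id (0 : ℂ)).mul_const K).neg).cexp
    have h4 := (h1.mul (h2.inv (by simpa using hne))).mul h3
    refine h4.congr_deriv ?_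
    simp
    field_simp
    ring
  have hr := (HasDerivAt.real_of_complex (z := 0) (by simpa using hq))
  have := hasDerivAt_nonpos_of_le (η := 1 / 4) (by norm_num) hr ?_
  · have hKre : K.re = Real.log ‖s + 2‖ + 19 := by simp [hK, Complex.log_re]
    simp only [Complex.neg_re, Complex.add_re, Complex.mul_re, hKre] at this
    simp at this
    linarith
  · intro x hx hx'
    have h5 := norm_zetaQuot_le hRH hx hx' hs.le
    have h6 := (Complex.re_le_norm _).trans h5
    simp only [zetaQuot] at h6
    have h7 : (1 / 2 - x + s : ℂ) = w - x := by rw [hw]; ring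
    have h8 : (1 / 2 + x + s : ℂ) = w + x := by rw [hw]; ring
    rw [h7, h8] at h6
    have h9 : riemannZeta₁ w * (riemannZeta₁ w)⁻¹ = 1 := mul_inv_cancel₀ hne
    simpa [h9] using h6

/-- Bound for `ζ'/ζ` to the right of `1 + x`, for small `x`. -/
lemma exists_norm_logDeriv_riemannZeta_le : ∃ η > (0 : ℝ), η ≤ 1 ∧ ∀ x : ℝ, 0 < x → x ≤ η →
    ∀ s : ℂ, 1 + x ≤ s.re → ‖deriv riemannZeta s / riemannZeta s‖ ≤
      8 / x ^ 2 * Real.exp (-(1 / 2) * (s.re - (1 + x))) := by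
  have h1 := tendsto_sub_mul_tsum_nat_rpow.eventually_le_const (u := 2) (by norm_num)
  obtain ⟨u, hu, hu'⟩ := mem_nhdsGT_iff_exists_Ioo_subset.1 h1
  have hu1 : (1 : ℝ) < u := hu
  refine ⟨min 1 (u - 1), by simp [hu1], min_le_left _ _, ?_⟩
  intro x hx hxη s hs
  have hxu : x ≤ u - 1 := hxη.trans (min_le_right _ _)
  have h2 : (1 + x / 2 - 1) * ∑' n : ℕ, 1 / (n : ℝ) ^ (1 + x / 2) ≤ 2 :=
    hu' ⟨by linarith, by linarith⟩
  have h3 : ∑' n : ℕ, 1 / (n : ℝ) ^ (1 + x / 2) ≤ 4 / x := by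
    rw [le_div_iff₀ hx]; linarith
  have hsum : Summable fun n : ℕ => 1 / (n : ℝ) ^ (1 + x / 2) :=
    Real.summable_one_div_nat_rpow.2 (by linarith)
  have hs1 : 1 < s.re := by linarith
  set E := Real.exp (-(1 / 2) * (s.re - (1 + x))) with hE
  have hL := ArithmeticFunction.LSeries_vonMangoldt_eq_deriv_riemannZeta_div hs1
  have hn : ‖deriv riemannZeta s / riemannZeta s‖ =
      ‖LSeries (fun n => ((ArithmeticFunction.vonMangoldt n : ℝ) : ℂ)) s‖ := by
    rw [hL, neg_div, norm_neg]
  rw [hn]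
  have hb : ∀ n : ℕ, ‖LSeries.term (fun n => ((ArithmeticFunction.vonMangoldt n : ℝ) : ℂ)) s n‖ ≤
      2 / x * E * (1 / (n : ℝ) ^ (1 + x / 2)) := by
    intro n
    rw [LSeries.norm_term_eq]
    have hEpos : 0 < E := Real.exp_pos _
    rcases lt_or_ge n 2 with h | h
    · have h0 : 0 ≤ 2 / x * E * (1 / (n : ℝ) ^ (1 + x / 2)) := by positivity
      interval_cases n
      · simpa using h0
      · simpa using h0
    rw [if_neg (by omega), Complex.norm_real,
      Real.norm_of_nonneg ArithmeticFunction.vonMangoldt_nonneg]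
    have hn2 : (2 : ℝ) ≤ n := by exact_mod_cast h
    have hn0 : (0 : ℝ) < n := by linarith
    have hlog : ArithmeticFunction.vonMangoldt n ≤ (n : ℝ) ^ (x / 2) / (x / 2) :=
      ArithmeticFunction.vonMangoldt_le_log.trans (Real.log_le_rpow_div hn0.le (by linarith))
    have hl2 : 1 / 2 ≤ Real.log n := by
      have := Real.log_le_log (by norm_num) hn2
      have := Real.log_two_gt_d9
      linarith
    have hp : 1 / (n : ℝ) ^ s.re ≤ E * (1 / (n : ℝ) ^ (1 + x)) := by
      rw [one_div, ← Real.rpow_neg hn0.le, one_div, ← Real.rpow_neg hn0.le,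
        Real.rpow_def_of_pos hn0, Real.rpow_def_of_pos hn0, hE, ← Real.exp_add]
      apply Real.exp_le_exp.2
      nlinarith
    calc _ = ArithmeticFunction.vonMangoldt n * (1 / (n : ℝ) ^ s.re) := by ring
      _ ≤ ((n : ℝ) ^ (x / 2) / (x / 2)) * (E * (1 / (n : ℝ) ^ (1 + x))) := by gcongr
      _ = 2 / x * E * ((n : ℝ) ^ (x / 2) / (n : ℝ) ^ (1 + x)) := by field_simp
      _ = _ := by
        rw [← Real.rpow_sub hn0, one_div, ← Real.rpow_neg hn0.le]
        congr 2; ring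
  have h4 := tsum_of_norm_bounded (hsum.mul_left (2 / x * E)).hasSum hb
  refine h4.trans ?_
  rw [tsum_mul_left]
  have hEpos : 0 < E := Real.exp_pos _
  calc _ ≤ 2 / x * E * (4 / x) := by gcongr
    _ = _ := by field_simp; norm_num

lemma logDeriv_riemannZeta₁ {s : ℂ} (hs : s ≠ 1) (h0 : riemannZeta₁ s ≠ 0) :
    deriv riemannZeta s / riemannZeta s = deriv riemannZeta₁ s / riemannZeta₁ s - (s - 1)⁻¹ := by
  have : s - 1 ≠ 0 := sub_ne_zero.2 hs
  rw [deriv_riemannZeta_eq_neg_inv_sub_sq_mul_add hs, riemannZeta_eq_inv_sub_mul hs]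
  field_simp
  ring

/-- Linear growth of `ζ₁'/ζ₁` strictly to the right of the critical line. -/
lemma exists_norm_logDeriv_le_mul (hRH : RiemannHypothesis) {ε : ℝ} (hε : 0 < ε) :
    ∃ B : ℝ, 0 ≤ B ∧ ∀ s : ℂ, ε ≤ s.re →
      ‖deriv riemannZeta₁ (1 / 2 + s) / riemannZeta₁ (1 / 2 + s)‖ ≤ B * (1 + ‖s‖) := by
  obtain ⟨η, hη, hη1, hb⟩ := exists_norm_logDeriv_riemannZeta_le
  set Q : ℝ := 8 / η ^ 2 + 1 with hQ
  have hQ0 : 0 ≤ Q := by positivity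
  have hfar : ∀ s : ℂ, 2 ≤ s.re →
      ‖deriv riemannZeta₁ (1 / 2 + s) / riemannZeta₁ (1 / 2 + s)‖ ≤ Q := by
    intro s hs
    have h1 : (1 / 2 + s : ℂ) ≠ 1 := by
      intro h
      have := congrArg Complex.re h
      simp at this; linarith
    have h2 := logDeriv_riemannZeta₁ h1 (riemannZeta₁_ne_zero hRH (by simp; linarith))
    have h3 := hb η hη le_rfl (1 / 2 + s) (by simp; linarith)
    have h4 : ‖((1 / 2 + s : ℂ) - 1)⁻¹‖ ≤ 1 := by
      rw [norm_inv]
      apply inv_le_one_of_one_le₀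
      have := Complex.re_le_norm ((1 / 2 + s : ℂ) - 1)
      simp at this ⊢
      linarith
    rw [h2] at h3
    have h5 := norm_sub_norm_le (deriv riemannZeta₁ (1 / 2 + s) / riemannZeta₁ (1 / 2 + s))
      ((1 / 2 + s : ℂ) - 1)⁻¹
    have h6 : Real.exp (-(1 / 2) * ((1 / 2 + s : ℂ).re - (1 + η))) ≤ 1 := by
      rw [Real.exp_le_one_iff]; simp; linarith
    have h7 : 8 / η ^ 2 * Real.exp (-(1 / 2) * ((1 / 2 + s : ℂ).re - (1 + η))) ≤ 8 / η ^ 2 :=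
      mul_le_of_le_one_right (by positivity) h6
    linarith
  refine ⟨Q + (80 + 4 * Q) / ε, by positivity, ?_⟩
  intro s hs
  have hns := norm_nonneg s
  rcases le_or_gt 2 s.re with h2 | h2
  · refine (hfar s h2).trans ?_
    have : 0 ≤ (80 + 4 * Q) / ε := by positivity
    nlinarith
  set c : ℂ := ⟨2, s.im⟩ with hc
  have hcs : s = c + ((s.re - 2 : ℝ) : ℂ) := by apply Complex.ext <;> simp [hc]
  have hcn : ‖c‖ ≤ 2 + ‖s‖ := by
    have := Complex.norm_le_abs_re_add_abs_im c
    have h3 := Complex.abs_im_le_norm s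
    simp [hc] at this
    linarith
  set f : ℂ → ℂ := fun z =>
    -(deriv riemannZeta₁ (1 / 2 + (c + z)) / riemannZeta₁ (1 / 2 + (c + z))) with hf
  have hre : ∀ z ∈ Metric.ball (0 : ℂ) 2, 0 < (c + z).re := by
    intro z hz
    rw [mem_ball_zero_iff] at hz
    have := (abs_le.1 ((Complex.abs_re_le_norm z))).1
    simp [hc]; linarith
  have hfd : DifferentiableOn ℂ f (Metric.ball 0 2) := by
    intro z hz
    apply DifferentiableAt.differentiableWithinAt
    have h0 : riemannZeta₁ (1 / 2 + (c + z)) ≠ 0 :=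
      riemannZeta₁_ne_zero hRH (by simpa using hre z hz)
    have h1 := (differentiable_riemannZeta₁.contDiff (n := 2)).differentiable_deriv_two
    have h2 := differentiable_riemannZeta₁
    fun_prop (disch := assumption)
  have hM : ∀ z ∈ Metric.ball (0 : ℂ) 2, (f z).re ≤ 20 + ‖s‖ := by
    intro z hz
    have h1 := neg_log_le_re_logDeriv hRH (hre z hz)
    have h2 := hre z hz
    have h3 : ‖c + z + 2‖ ≤ 6 + ‖s‖ := by
      rw [mem_ball_zero_iff] at hz
      refine (norm_add₃_le).trans ?_
      simp only [Complex.norm_ofNat]; linarith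
    have h4 : 0 < ‖c + z + 2‖ := by
      have := Complex.re_le_norm (c + z + 2)
      simp only [Complex.add_re] at this h2
      simp at this; linarith
    have h5 := Real.log_le_sub_one_of_pos h4
    simp only [hf, Complex.neg_re]
    linarith
  have hz : ((s.re - 2 : ℝ) : ℂ) ∈ Metric.ball (0 : ℂ) 2 := by
    rw [mem_ball_zero_iff, Complex.norm_real, Real.norm_eq_abs, abs_lt]; constructor <;> linarith
  have hzn : ‖((s.re - 2 : ℝ) : ℂ)‖ ≤ 2 - ε := by
    rw [Complex.norm_real, Real.norm_eq_abs, abs_le]; constructor <;> linarith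
  have hBC := Complex.borelCaratheodory (M := 20 + ‖s‖) (by positivity) hfd hM (by norm_num) hz
  have hf0 : ‖f 0‖ ≤ Q := by
    simp only [hf, norm_neg, add_zero]
    exact hfar c (by simp [hc])
  have hval : ‖f ((s.re - 2 : ℝ) : ℂ)‖ =
      ‖deriv riemannZeta₁ (1 / 2 + s) / riemannZeta₁ (1 / 2 + s)‖ := by
    simp only [hf, norm_neg, ← hcs]
  rw [hval] at hBC
  set z := ((s.re - 2 : ℝ) : ℂ)
  have hz4 : 0 ≤ ‖z‖ := norm_nonneg z
  calc _ ≤ _ := hBC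
    _ ≤ 2 * (20 + ‖s‖) * 2 / ε + Q * (2 + 2) / ε := by gcongr <;> linarith
    _ = (80 + 4 * ‖s‖ + 4 * Q) / ε := by ring
    _ ≤ (80 + 4 * Q) * (1 + ‖s‖) / ε := by
      gcongr
      nlinarith [mul_nonneg hQ0 hns]
    _ ≤ (Q + (80 + 4 * Q) / ε) * (1 + ‖s‖) := by
      rw [add_mul Q, div_mul_eq_mul_div]
      nlinarith [mul_nonneg hQ0 hns]

lemma differentiableAt_logDeriv_riemannZeta₁ {w : ℂ} (hw : riemannZeta₁ w ≠ 0) :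
    DifferentiableAt ℂ (fun w => deriv riemannZeta₁ w / riemannZeta₁ w) w :=
  ((differentiable_riemannZeta₁.contDiff (n := 2)).differentiable_deriv_two w).div
    (differentiable_riemannZeta₁ w) hw

/-- The contour bound applied to `ζ₁'/ζ₁` slightly to the right of the critical line. -/
lemma exists_shifted_integral_bound (hRH : RiemannHypothesis) :
    ∃ C > (0 : ℝ), ∃ x₁ > (0 : ℝ), x₁ ≤ 1 ∧ ∀ (τ x ε : ℝ), 0 < x → x ≤ x₁ → 0 < ε →
      -2 * (1 / (π * x)) * (∫ a in (0 : ℝ)..(1 / 2 + x),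
        deriv riemannZeta₁ (1 / 2 + (ε + τ * I + a)) /
          riemannZeta₁ (1 / 2 + (ε + τ * I + a))).im ≤
      1 / 2 * Real.log (3 + ε + |τ|) + C + C * (1 / x ^ 2) * Real.exp (1 / x) := by
  obtain ⟨C, hC, hcontour⟩ := exists_contour_bound
  obtain ⟨η, hη, hη1, hζ⟩ := exists_norm_logDeriv_riemannZeta_le
  have hπ := Real.pi_pos
  have hπ3 := Real.pi_gt_three
  have hπ4 := Real.pi_lt_four
  refine ⟨C * 9 * Real.exp 2 + 10 + C, by positivity, min η (1 / 8), by positivity,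
    (min_le_left _ _).trans hη1, ?_⟩
  intro τ x ε hx hxx hε
  have hx8 : x ≤ 1 / 8 := hxx.trans (min_le_right _ _)
  have hxη : x ≤ η := hxx.trans (min_le_left _ _)
  set lam : ℝ := 1 / (π * x) with hlam
  have hlam1 : 2 ≤ lam := by
    rw [hlam, le_div_iff₀ (by positivity)]; nlinarith
  have hlam0 : 0 < lam := by linarith
  have hlamC : (lam : ℂ) ≠ 0 := by exact_mod_cast hlam0.ne'
  set b : ℝ := 1 / 2 + x with hb
  set Z : ℂ → ℂ := fun s => deriv riemannZeta₁ (1 / 2 + s) / riemannZeta₁ (1 / 2 + s) with hZ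
  have hZd : ∀ s : ℂ, 0 < s.re → DifferentiableAt ℂ Z s := by
    intro s hs
    have h0 : riemannZeta₁ (1 / 2 + s) ≠ 0 := riemannZeta₁_ne_zero hRH (by simpa using hs)
    exact (differentiableAt_logDeriv_riemannZeta₁ h0).fun_comp' s
      ((differentiableAt_const _).add differentiableAt_id)
  obtain ⟨B, hB, hgrow⟩ := exists_norm_logDeriv_le_mul hRH hε
  set φ : ℂ → ℂ := fun z => ε + τ * I - I * z / lam with hφ
  have hφre : ∀ z : ℂ, (φ z).re = ε + z.im / lam := by
    intro z
    simp [hφ, Complex.div_ofReal_re]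
    ring
  have hφn : ∀ z : ℂ, ‖φ z‖ ≤ ε + |τ| + ‖z‖ := by
    intro z
    have h1 : ‖I * z / lam‖ ≤ ‖z‖ := by
      rw [norm_div, norm_mul, Complex.norm_I, one_mul, Complex.norm_real,
        Real.norm_of_nonneg hlam0.le]
      exact div_le_self (norm_nonneg _) (by linarith)
    have h2 : ‖(ε + τ * I : ℂ)‖ ≤ ε + |τ| := by
      refine (norm_add_le _ _).trans ?_
      rw [norm_mul, Complex.norm_I, mul_one, Complex.norm_real, Complex.norm_real,
        Real.norm_of_nonneg hε.le, Real.norm_eq_abs]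
    exact (norm_sub_le _ _).trans (by linarith)
  have hτ := abs_nonneg τ
  have hmain := hcontour (fun z => Z (φ z)) (1 / 2 * Real.log (3 + ε + |τ|) + 10)
    (B * (1 + ε + |τ|)) (9 / x ^ 2) (lam * b) ?_ ?_ ?_ ?_ ?_ ?_
  · have hint : ∫ y in (0 : ℝ)..(lam * b), Z (φ (I * y)) =
        lam * ∫ a in (0 : ℝ)..b, Z (ε + τ * I + a) := by
      have h1 := intervalIntegral.integral_comp_mul_left (a := 0) (b := b)
        (fun y : ℝ => Z (φ (I * y))) hlam0.ne'
      rw [mul_zero] at h1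
      have h2 : ∀ a : ℝ, φ (I * ((lam * a : ℝ) : ℂ)) = ε + τ * I + a := by
        intro a
        simp only [hφ]
        rw [← mul_assoc, Complex.I_mul_I]
        push_cast
        field_simp
        ring
      simp only [h2] at h1
      rw [h1, Complex.real_smul, ← mul_assoc, ← Complex.ofReal_mul, mul_inv_cancel₀ hlam0.ne',
        Complex.ofReal_one, one_mul]
    rw [hint, Complex.im_ofReal_mul] at hmain
    have hexp : Real.exp (2 * π * (lam * b)) = Real.exp 2 * Real.exp (1 / x) := by
      rw [← Real.exp_add]
      congr 1
      rw [hlam, hb]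
      field_simp
      ring
    rw [hexp] at hmain
    have hE := Real.exp_pos (1 / x)
    have hE2 := Real.exp_pos 2
    have hsq : 0 ≤ 1 / x ^ 2 := by positivity
    calc _ = -2 * (lam * (∫ a in (0 : ℝ)..b, Z (ε + τ * I + a)).im) := by ring
      _ ≤ _ := hmain
      _ = 1 / 2 * Real.log (3 + ε + |τ|) + (10 + C) +
        (C * 9 * Real.exp 2) * (1 / x ^ 2) * Real.exp (1 / x) := by ring
      _ ≤ _ := by
        gcongr
        · have : 0 ≤ C * 9 * Real.exp 2 := by positivity
          linarith
        · linarith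
  · rw [hlam, hb]
    rw [div_mul_eq_mul_div, le_div_iff₀ (by positivity)]
    nlinarith
  · have : 0 ≤ Real.log (3 + ε + |τ|) := Real.log_nonneg (by linarith)
    positivity
  · intro z hz
    have : 0 < (φ z).re := by
      rw [hφre]; positivity
    have hd : DifferentiableAt ℂ φ z := by simp only [hφ]; fun_prop
    exact (hZd _ this).fun_comp' z hd
  · intro z hz _
    refine (hgrow (φ z) ?_).trans ?_
    · rw [hφre]
      have : 0 ≤ z.im / lam := by positivity
      linarith
    · rw [mul_assoc]
      gcongr
      have := hφn z
      have := norm_nonneg z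
      nlinarith
  · intro u
    set s := φ (u + (lam * b : ℝ) * I) with hs
    have hsre : s.re = ε + b := by
      rw [hs, hφre]
      simp
      field_simp
    have hne1 : (1 / 2 + s : ℂ) ≠ 1 := by
      intro h
      have := congrArg Complex.re h
      simp [hsre, hb] at this
      linarith
    have h2 := logDeriv_riemannZeta₁ hne1 (riemannZeta₁_ne_zero hRH (by simp [hsre, hb]; positivity))
    have h3 := hζ x hx hxη (1 / 2 + s) (by simp [hsre, hb]; linarith)
    rw [h2] at h3
    have h4 : ‖((1 / 2 + s : ℂ) - 1)⁻¹‖ ≤ 1 / x ^ 2 := by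
      rw [norm_inv, ← one_div]
      have h5 := Complex.re_le_norm ((1 / 2 + s : ℂ) - 1)
      have h6 : ((1 / 2 + s : ℂ) - 1).re = ε + x := by simp [hsre, hb]; ring
      rw [h6] at h5
      gcongr
      nlinarith
    have h5 := norm_sub_norm_le (deriv riemannZeta₁ (1 / 2 + s) / riemannZeta₁ (1 / 2 + s))
      ((1 / 2 + s : ℂ) - 1)⁻¹
    have h6 : Real.exp (-(1 / 2) * ((1 / 2 + s : ℂ).re - (1 + x))) ≤ 1 := by
      rw [Real.exp_le_one_iff]; simp [hsre, hb]; linarith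
    have h7 : 8 / x ^ 2 * Real.exp (-(1 / 2) * ((1 / 2 + s : ℂ).re - (1 + x))) ≤ 8 / x ^ 2 :=
      mul_le_of_le_one_right (by positivity) h6
    have h8 : (9 : ℝ) / x ^ 2 = 8 / x ^ 2 + 1 / x ^ 2 := by ring
    rw [h8]
    linarith
  · intro u
    have hre : 0 < (φ u).re := by rw [hφre]; simpa using hε
    refine le_trans ?_ (neg_log_le_re_logDeriv hRH hre)
    have h1 : ‖φ u + 2‖ ≤ (3 + ε + |τ|) * (1 + |u|) := by
      refine (norm_add_le _ _).trans ?_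
      have := hφn u
      rw [Complex.norm_real, Real.norm_eq_abs] at this
      simp only [Complex.norm_ofNat]
      have := abs_nonneg u
      nlinarith
    have h2 : 0 < ‖φ u + 2‖ := by
      have := Complex.re_le_norm (φ u + 2)
      simp at this
      linarith
    have h3 := Real.log_le_log h2 h1
    have hu := abs_nonneg u
    rw [Real.log_mul (by positivity) (by positivity)] at h3
    linarith

lemma riemannZeta₁_half_add_ne_zero (hRH : RiemannHypothesis) {τ : ℝ}
    (h0 : riemannZeta₁ (1 / 2 + τ * I) ≠ 0) {a : ℝ} (ha : 0 ≤ a) :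
    riemannZeta₁ (1 / 2 + (τ * I + a)) ≠ 0 := by
  rcases ha.eq_or_lt with rfl | h
  · simpa using h0
  · exact riemannZeta₁_ne_zero hRH (by simpa using h)

lemma continuousOn_logDeriv (hRH : RiemannHypothesis) {τ : ℝ}
    (h0 : riemannZeta₁ (1 / 2 + τ * I) ≠ 0) :
    ContinuousOn (fun a : ℝ => deriv riemannZeta₁ (1 / 2 + (τ * I + a)) /
          riemannZeta₁ (1 / 2 + (τ * I + a))) (Set.Ici 0) := by
  intro a ha
  have h1 := riemannZeta₁_half_add_ne_zero hRH h0 (a := a) ha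
  exact (ContinuousAt.comp (f := fun a : ℝ => (1 / 2 + (τ * I + a) : ℂ))
    (differentiableAt_logDeriv_riemannZeta₁ h1).continuousAt (by fun_prop)).continuousWithinAt

/-- The contour bound for `ζ₁'/ζ₁` on a horizontal segment starting on the critical line. -/
lemma exists_integral_bound (hRH : RiemannHypothesis) :
    ∃ C > (0 : ℝ), ∃ x₁ > (0 : ℝ), x₁ ≤ 1 ∧ ∀ (τ x : ℝ), 0 < x → x ≤ x₁ →
      riemannZeta₁ (1 / 2 + τ * I) ≠ 0 →
      -2 * (1 / (π * x)) * (∫ a in (0 : ℝ)..(1 / 2 + x),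
        deriv riemannZeta₁ (1 / 2 + (τ * I + a)) /
          riemannZeta₁ (1 / 2 + (τ * I + a))).im ≤
      1 / 2 * Real.log (4 + |τ|) + C + C * (1 / x ^ 2) * Real.exp (1 / x) := by
  obtain ⟨C, hC, x₁, hx₁, hx₁', h⟩ := exists_shifted_integral_bound hRH
  refine ⟨C, hC, x₁, hx₁, hx₁', fun τ x hx hxx h0 => ?_⟩
  set b : ℝ := 1 / 2 + x with hb
  have hτ := abs_nonneg τ
  set f : ℝ → ℂ := fun a => deriv riemannZeta₁ (1 / 2 + (τ * I + a)) /
          riemannZeta₁ (1 / 2 + (τ * I + a)) with hf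
  have hfc : ContinuousOn f (Set.Ici 0) := continuousOn_logDeriv hRH h0
  have hfi : ∀ u v : ℝ, 0 ≤ u → 0 ≤ v → IntervalIntegrable f volume u v := fun u v hu hv =>
    (hfc.mono fun y hy => le_trans (le_min hu hv) hy.1).intervalIntegrable
  have hshift : ∀ ε : ℝ, 0 < ε → ∫ a in (0 : ℝ)..b,
      deriv riemannZeta₁ (1 / 2 + (ε + τ * I + a)) / riemannZeta₁ (1 / 2 + (ε + τ * I + a)) =
      (∫ a in (0 : ℝ)..(b + ε), f a) - ∫ a in (0 : ℝ)..ε, f a := by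
    intro ε hε
    have h1 := intervalIntegral.integral_comp_add_right (a := 0) (b := b) f ε
    rw [zero_add] at h1
    rw [intervalIntegral.integral_interval_sub_left (hfi _ _ le_rfl (by positivity))
      (hfi _ _ le_rfl hε.le), ← h1]
    refine intervalIntegral.integral_congr fun a _ => ?_
    have : (ε + τ * I + a : ℂ) = τ * I + ((a + ε : ℝ) : ℂ) := by push_cast; ring
    simp only [hf, this]
  have hG : ContinuousOn (fun y => ∫ a in (0 : ℝ)..y, f a) (Set.Icc 0 (b + 1)) := by
    have := intervalIntegral.continuousOn_primitive_interval' (a := 0)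
      (hfi 0 (b + 1) le_rfl (by positivity)) (by simp)
    rwa [Set.uIcc_of_le (by positivity)] at this
  have hl1 : Filter.Tendsto (fun ε : ℝ => ∫ a in (0 : ℝ)..(b + ε), f a) (nhdsWithin 0 (Set.Ioi 0))
      (nhds (∫ a in (0 : ℝ)..b, f a)) := by
    have h1 : ContinuousAt (fun y => ∫ a in (0 : ℝ)..y, f a) (b + 0) :=
      hG.continuousAt (Icc_mem_nhds (by rw [add_zero]; positivity) (by linarith))
    have h2 : Filter.Tendsto (fun ε : ℝ => b + ε) (nhdsWithin 0 (Set.Ioi 0)) (nhds (b + 0)) :=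
      (Continuous.tendsto (by fun_prop) 0).mono_left nhdsWithin_le_nhds
    have h3 := h1.tendsto.comp h2
    simp only [add_zero] at h3
    exact h3
  have hl2 : Filter.Tendsto (fun ε : ℝ => ∫ a in (0 : ℝ)..ε, f a) (nhdsWithin 0 (Set.Ioi 0))
      (nhds 0) := by
    have h1 := (hG 0 ⟨le_rfl, by positivity⟩).mono_left
      (nhdsWithin_le_of_mem
        (Filter.mem_of_superset (Ioc_mem_nhdsGT (show (0 : ℝ) < b + 1 by positivity))
          Set.Ioc_subset_Icc_self))
    simpa using h1
  have hl := (((Complex.continuous_im.tendsto _).comp (hl1.sub hl2))).const_mul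
    (-2 * (1 / (π * x)))
  rw [sub_zero] at hl
  refine le_of_tendsto hl ?_
  filter_upwards [Ioc_mem_nhdsGT (one_pos (α := ℝ))] with ε hε
  have h3 := h τ x ε hx hxx hε.1
  rw [hshift ε hε.1] at h3
  refine h3.trans ?_
  gcongr
  · linarith [hε.1]
  · linarith [hε.2]

/-- The tail of the integral defining `S`. -/
lemma abs_integral_tail_le {x : ℝ} {F : ℝ → ℝ}
    (hF : ContinuousOn F (Set.Ioi (1 + x)))
    (h : ∀ σ : ℝ, 1 + x < σ → |F σ| ≤ 8 / x ^ 2 * Real.exp (-(1 / 2) * (σ - (1 + x)))) :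
    IntegrableOn F (Set.Ioi (1 + x)) ∧ |∫ σ in Set.Ioi (1 + x), F σ| ≤ 16 / x ^ 2 := by
  have e : ∀ σ : ℝ, 8 / x ^ 2 * Real.exp (-(1 / 2) * (σ - (1 + x))) =
      8 / x ^ 2 * Real.exp (1 / 2 * (1 + x)) * Real.exp (-(1 / 2) * σ) := by
    intro σ
    rw [mul_assoc, ← Real.exp_add]
    congr 2; ring
  have hi : IntegrableOn (fun σ : ℝ => 8 / x ^ 2 * Real.exp (-(1 / 2) * (σ - (1 + x))))
      (Set.Ioi (1 + x)) := by
    simp only [e]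
    exact (integrableOn_exp_mul_Ioi (by norm_num) _).const_mul _
  have hv : ∫ σ in Set.Ioi (1 + x), 8 / x ^ 2 * Real.exp (-(1 / 2) * (σ - (1 + x))) =
      16 / x ^ 2 := by
    simp only [e]
    rw [integral_const_mul, integral_exp_mul_Ioi (by norm_num)]
    have : Real.exp (1 / 2 * (1 + x)) * Real.exp (-(1 / 2) * (1 + x)) = 1 := by
      rw [← Real.exp_add]; simp
    linear_combination (16 / x ^ 2) * this
  have hb : ∀ᵐ σ ∂(volume.restrict (Set.Ioi (1 + x))),
      ‖F σ‖ ≤ 8 / x ^ 2 * Real.exp (-(1 / 2) * (σ - (1 + x))) :=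
    (ae_restrict_iff' measurableSet_Ioi).2 (Filter.Eventually.of_forall fun σ hσ => h σ hσ)
  refine ⟨hi.mono' (hF.aestronglyMeasurable measurableSet_Ioi) hb, ?_⟩
  rw [← hv]
  exact norm_integral_le_of_norm_le hi hb

lemma exists_S_le (hRH : RiemannHypothesis) :
    ∃ C > (0 : ℝ), ∃ x₁ > (0 : ℝ), ∀ (τ x : ℝ), 0 < x → x ≤ x₁ → 1 ≤ |τ| →
      riemannZeta₁ (1 / 2 + τ * I) ≠ 0 →
      S τ ≤ x / 2 * (1 / 2 * Real.log (4 + |τ|) + C + C * (1 / x ^ 2) * Real.exp (1 / x)) +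
        20 / x ^ 2 := by
  obtain ⟨C, hC, x₁, hx₁, hx₁', h⟩ := exists_integral_bound hRH
  obtain ⟨η, hη, hη1, hζ⟩ := exists_norm_logDeriv_riemannZeta_le
  refine ⟨C, hC, min x₁ η, by positivity, fun τ x hx hxx hτ h0 => ?_⟩
  have hxη : x ≤ η := hxx.trans (min_le_right _ _)
  have h := h τ x hx (hxx.trans (min_le_left _ _)) h0
  have hx1 : x ≤ 1 := hxη.trans hη1
  set F : ℝ → ℝ := fun σ => (deriv riemannZeta ((σ : ℂ) + (τ : ℂ) * Complex.I) /
      riemannZeta ((σ : ℂ) + (τ : ℂ) * Complex.I)).im with hF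
  have hne1 : ∀ σ : ℝ, (σ + τ * I : ℂ) ≠ 1 := by
    intro σ h
    have := congrArg Complex.im h
    simp at this
    rw [this] at hτ
    norm_num at hτ
  have hinv : ∀ a : ℝ, ‖((1 / 2 + (τ * I + a) : ℂ) - 1)⁻¹‖ ≤ 1 := by
    intro a
    rw [norm_inv]
    apply inv_le_one_of_one_le₀
    have := Complex.abs_im_le_norm ((1 / 2 + (τ * I + a) : ℂ) - 1)
    simp at this ⊢
    linarith
  have heq : ∀ a : ℝ, 0 ≤ a → F (a + 1 / 2) = (deriv riemannZeta₁ (1 / 2 + (τ * I + a)) /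
      riemannZeta₁ (1 / 2 + (τ * I + a))).im - (((1 / 2 + (τ * I + a) : ℂ) - 1)⁻¹).im := by
    intro a ha
    have e : (((a + 1 / 2 : ℝ) : ℂ) + τ * I : ℂ) = 1 / 2 + (τ * I + a) := by push_cast; ring
    have h1 := logDeriv_riemannZeta₁ (by rw [← e]; exact hne1 _)
      (riemannZeta₁_half_add_ne_zero hRH h0 ha)
    simp only [hF]
    rw [e, h1, Complex.sub_im]
  have hZc := continuousOn_logDeriv hRH h0
  have hIc : Continuous fun a : ℝ => ((1 / 2 + (τ * I + a) : ℂ) - 1)⁻¹ := by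
    refine Continuous.inv₀ (by fun_prop) ?_
    intro a h
    have := hinv a
    have h2 := congrArg Complex.im h
    simp at h2
    rw [h2] at hτ
    norm_num at hτ
  have hFc : ContinuousOn F (Set.Ici (1 / 2)) := by
    have h1 : ContinuousOn (fun σ : ℝ => F ((σ - 1 / 2) + 1 / 2)) (Set.Ici (1 / 2)) := by
      have h2 : ContinuousOn (fun a => F (a + 1 / 2)) (Set.Ici 0) :=
        ((Complex.continuous_im.comp_continuousOn hZc).sub
          (Complex.continuous_im.comp_continuousOn hIc.continuousOn)).congr heq
      refine h2.comp (f := fun σ : ℝ => σ - 1 / 2) (by fun_prop) ?_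
      intro σ hσ
      simpa using hσ
    simpa using h1
  obtain ⟨htail, htail'⟩ := abs_integral_tail_le (x := x) (F := F)
    (hFc.mono fun σ hσ => by simp at hσ ⊢; linarith) (fun σ hσ => by
      refine (Complex.abs_im_le_norm _).trans ?_
      have := hζ x hx hxη (σ + τ * I) (by simpa using hσ.le)
      simpa using this)
  have hint1 : IntervalIntegrable F volume (1 / 2) (1 + x) :=
    (hFc.mono fun σ hσ => by
      rw [Set.uIcc_of_le (by linarith)] at hσ
      exact hσ.1).intervalIntegrable
  have hsplit := intervalIntegral.integral_interval_add_Ioi' hint1 htail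
  have hshift : ∫ σ in (1 / 2 : ℝ)..(1 + x), F σ = ∫ a in (0 : ℝ)..(1 / 2 + x), F (a + 1 / 2) := by
    rw [intervalIntegral.integral_comp_add_right (fun a => F a)]
    congr 1 <;> ring
  have hb0 : (0 : ℝ) ≤ 1 / 2 + x := by positivity
  have hiZ : IntervalIntegrable (fun a : ℝ => deriv riemannZeta₁ (1 / 2 + (τ * I + a)) /
      riemannZeta₁ (1 / 2 + (τ * I + a))) volume 0 (1 / 2 + x) :=
    (hZc.mono fun a ha => by rw [Set.uIcc_of_le hb0] at ha; exact ha.1).intervalIntegrable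
  have hval : ∫ a in (0 : ℝ)..(1 / 2 + x), F (a + 1 / 2) =
      (∫ a in (0 : ℝ)..(1 / 2 + x), deriv riemannZeta₁ (1 / 2 + (τ * I + a)) /
        riemannZeta₁ (1 / 2 + (τ * I + a))).im -
      ∫ a in (0 : ℝ)..(1 / 2 + x), (((1 / 2 + (τ * I + a) : ℂ) - 1)⁻¹).im := by
    rw [intervalIntegral.integral_congr (g := fun a : ℝ =>
      (deriv riemannZeta₁ (1 / 2 + (τ * I + a)) /
      riemannZeta₁ (1 / 2 + (τ * I + a))).im - (((1 / 2 + (τ * I + a) : ℂ) - 1)⁻¹).im)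
      (fun a ha => heq a (by rw [Set.uIcc_of_le hb0] at ha; exact ha.1))]
    refine (intervalIntegral.integral_sub ⟨hiZ.1.im, hiZ.2.im⟩
      ((Complex.continuous_im.comp hIc).intervalIntegrable _ _)).trans ?_
    congr 1
    exact intervalIntegral.intervalIntegral_im hiZ
  have hsmall : |∫ a in (0 : ℝ)..(1 / 2 + x), (((1 / 2 + (τ * I + a) : ℂ) - 1)⁻¹).im| ≤ 2 := by
    have := intervalIntegral.norm_integral_le_of_norm_le_const (a := 0) (b := 1 / 2 + x) (C := 1)
      (f := fun a : ℝ => (((1 / 2 + (τ * I + a) : ℂ) - 1)⁻¹).im)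
      (fun a _ => (Complex.abs_im_le_norm _).trans (hinv a))
    rw [Real.norm_eq_abs, sub_zero, abs_of_nonneg hb0] at this
    linarith
  have hS : S τ = -(1 / π) * ∫ σ in Set.Ioi (1 / 2 : ℝ), F σ := rfl
  rw [hS, ← hsplit, hshift, hval]
  set J := (∫ a in (0 : ℝ)..(1 / 2 + x), deriv riemannZeta₁ (1 / 2 + (τ * I + a)) /
        riemannZeta₁ (1 / 2 + (τ * I + a))).im
  set T := ∫ σ in Set.Ioi (1 + x), F σ
  set V := ∫ a in (0 : ℝ)..(1 / 2 + x), (((1 / 2 + (τ * I + a) : ℂ) - 1)⁻¹).im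
  have hπ := Real.pi_gt_three
  have h1 := mul_le_mul_of_nonneg_left h (show 0 ≤ x / 2 by positivity)
  have h2 : x / 2 * (-2 * (1 / (π * x)) * J) = -(1 / π) * J := by field_simp
  rw [h2] at h1
  have h3 : -(1 / π) * (T - V) ≤ 20 / x ^ 2 := by
    have h4 : |T - V| ≤ 16 / x ^ 2 + 2 := (abs_sub _ _).trans (add_le_add htail' hsmall)
    have h5 : 2 ≤ 4 / x ^ 2 := by
      rw [le_div_iff₀ (by positivity)]; nlinarith
    have h6 : |-(1 / π) * (T - V)| ≤ |T - V| := by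
      rw [abs_mul, abs_neg, abs_of_nonneg (by positivity)]
      refine mul_le_of_le_one_left (abs_nonneg _) ?_
      rw [div_le_one (by positivity)]; linarith
    have h7 : (20 : ℝ) / x ^ 2 = 16 / x ^ 2 + 4 / x ^ 2 := by ring
    linarith [le_abs_self (-(1 / π) * (T - V))]
  linarith

lemma deriv_riemannZeta_conj (s : ℂ) :
    deriv riemannZeta ((starRingEnd ℂ) s) = (starRingEnd ℂ) (deriv riemannZeta s) := by
  have h : (starRingEnd ℂ) ∘ riemannZeta ∘ (starRingEnd ℂ) = riemannZeta := by
    ext s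
    simp [riemannZeta_conj]
  have := congrFun (deriv_conj_conj (𝕜 := ℂ) (f := riemannZeta)) ((starRingEnd ℂ) s)
  simpa [h] using this

lemma S_neg (t : ℝ) : S (-t) = -S t := by
  have h : ∀ σ : ℝ, ((σ : ℂ) + ((-t : ℝ) : ℂ) * Complex.I) =
      (starRingEnd ℂ) ((σ : ℂ) + (t : ℂ) * Complex.I) := by
    intro σ
    simp
  unfold S
  simp only [h, deriv_riemannZeta_conj, riemannZeta_conj, ← map_div₀, Complex.conj_im,
    integral_neg]
  ring

lemma riemannZeta₁_half_ne_zero {t : ℝ} (ht : t ≠ 0) (h : ¬ IsZetaZeroOrdinate t) :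
    riemannZeta₁ (1 / 2 + t * I) ≠ 0 ∧ riemannZeta₁ (1 / 2 + (-t : ℝ) * I) ≠ 0 := by
  have hz : riemannZeta (1 / 2 + t * I) ≠ 0 := fun h0 =>
    h ⟨1 / 2 + t * I, h0, by norm_num, by norm_num, by simp⟩
  have hc : ((1 / 2 + (-t : ℝ) * I : ℂ)) = (starRingEnd ℂ) (1 / 2 + t * I) := by
    simp [Complex.conj_ofNat]
  have hz' : riemannZeta (1 / 2 + (-t : ℝ) * I) ≠ 0 := by
    rw [hc, riemannZeta_conj]
    simpa using hz
  have hne : ∀ u : ℝ, u ≠ 0 → (1 / 2 + u * I : ℂ) ≠ 1 := fun u hu h1 =>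
    hu (by simpa using congrArg Complex.im h1)
  have key : ∀ u : ℝ, u ≠ 0 → riemannZeta (1 / 2 + u * I) ≠ 0 →
      riemannZeta₁ (1 / 2 + u * I) ≠ 0 := by
    intro u hu h0
    rw [← norm_ne_zero_iff, norm_riemannZeta₁ (hne u hu)]
    exact mul_ne_zero (norm_ne_zero_iff.2 (sub_ne_zero.2 (hne u hu))) (norm_ne_zero_iff.2 h0)
  exact ⟨key t ht hz, key (-t) (neg_ne_zero.2 ht) hz'⟩

lemma S_bound_le_of_parameters {C L l M P : ℝ} (hC : 0 < C) (hl : 1 ≤ l) (hlL : 8 * l ≤ L)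
    (hM : L ^ 4 ≤ M) (hP : P ≤ M + 2) :
    (1 / (L - 4 * l)) / 2 * (1 / 2 * P + C + C * (1 / (1 / (L - 4 * l)) ^ 2) * (M / L ^ 4)) +
      20 / (1 / (L - 4 * l)) ^ 2 ≤ 1 / 4 * M / L + (23 + 2 * C) * (M * l) / L ^ 2 := by
  have hL : 8 ≤ L := by linarith
  set K := L - 4 * l with hK
  have hKL : L / 2 ≤ K := by linarith
  have hK0 : 0 < K := by linarith
  have hKL' : K ≤ L := by linarith
  have hM0 : 0 < M := lt_of_lt_of_le (by positivity) hM
  have hlhs : (1 / K) / 2 * (1 / 2 * P + C + C * (1 / (1 / K) ^ 2) * (M / L ^ 4)) +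
      20 / (1 / K) ^ 2 = P / (4 * K) + C / (2 * K) + C / 2 * (K * (M / L ^ 4)) + 20 * K ^ 2 := by
    field_simp
    ring
  rw [hlhs]
  set Q := M * l / L ^ 2 with hQ
  have hMQ : M / L ^ 2 ≤ Q := by
    rw [hQ]; gcongr; nlinarith
  have hLQ : L ^ 2 ≤ Q := by
    refine le_trans ?_ hMQ
    rw [le_div_iff₀ (by positivity)]
    linarith [show L ^ 2 * L ^ 2 = L ^ 4 by ring]
  have hinv : 1 / (2 * K) ≤ Q := by
    have : 1 / (2 * K) ≤ 1 := by rw [div_le_one (by positivity)]; linarith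
    nlinarith
  have h1 : M / (4 * K) ≤ 1 / 4 * M / L + 2 * Q := by
    have e : M / (4 * K) = 1 / 4 * M / L + M * l / (L * K) := by
      rw [hK] at hK0 ⊢
      have : L - 4 * l ≠ 0 := hK0.ne'
      field_simp
      ring
    have : M * l / (L * K) ≤ 2 * Q := by
      rw [hQ, ← mul_div_assoc, div_le_div_iff₀ (by positivity) (by positivity)]
      have : 0 ≤ M * l * L * (2 * K - L) := mul_nonneg (by positivity) (by linarith)
      nlinarith
    linarith
  have h2 : P / (4 * K) ≤ M / (4 * K) + 1 / (2 * K) := by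
    have : P / (4 * K) ≤ (M + 2) / (4 * K) := by gcongr
    have e : (M + 2) / (4 * K) = M / (4 * K) + 1 / (2 * K) := by field_simp; ring
    linarith
  have h3 : C / (2 * K) ≤ C * Q := by
    have := mul_le_mul_of_nonneg_left hinv hC.le
    rwa [mul_one_div] at this
  have h4 : C / 2 * (K * (M / L ^ 4)) ≤ C / 2 * Q := by
    refine mul_le_mul_of_nonneg_left (le_trans ?_ hMQ) (by positivity)
    have : K * (M / L ^ 4) ≤ L ^ 2 * (M / L ^ 4) := by
      gcongr
      nlinarith
    refine this.trans (le_of_eq ?_)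
    field_simp
  have h5 : 20 * K ^ 2 ≤ 20 * Q := by
    have : K ^ 2 ≤ L ^ 2 := by gcongr
    linarith
  have hQ0 : 0 ≤ C * Q := by positivity
  have e : (23 + 2 * C) * (M * l) / L ^ 2 = 23 * Q + 2 * (C * Q) := by rw [hQ]; ring
  rw [e]
  linarith

lemma eventually_parameter_conditions (x₁ : ℝ) :
    ∀ᶠ L : ℝ in Filter.atTop, 1 ≤ Real.log L ∧ 8 * Real.log L ≤ L ∧ L ^ 4 ≤ Real.exp L ∧
      2 / x₁ ≤ L := by
  have h1 := Real.tendsto_log_atTop.eventually_ge_atTop 1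
  have h2 := Real.isLittleO_log_id_atTop.bound (show (0 : ℝ) < 1 / 8 by norm_num)
  have h3 := (isLittleO_pow_exp_atTop (n := 4)).bound (show (0 : ℝ) < 1 by norm_num)
  filter_upwards [h1, h2, h3, Filter.eventually_ge_atTop (2 / x₁), Filter.eventually_ge_atTop 0]
    with L h1 h2 h3 h4 h5
  refine ⟨h1, ?_, ?_, h4⟩
  · rw [Real.norm_eq_abs, Real.norm_eq_abs, id, abs_of_nonneg h5] at h2
    linarith [le_abs_self (Real.log L)]
  · rw [Real.norm_eq_abs, Real.norm_eq_abs, Real.abs_exp] at h3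
    linarith [le_abs_self (L ^ 4)]

theorem abs_S_le (hRH : RiemannHypothesis) :
    ∃ C > 0, ∃ t₀ : ℝ, ∀ t ≥ t₀, ¬ IsZetaZeroOrdinate t →
      |S t| ≤ (1 / 4) * Real.log t / Real.log (Real.log t) +
        C * (Real.log t * Real.log (Real.log (Real.log t))) / (Real.log (Real.log t)) ^ 2 := by
  obtain ⟨C, hC, x₁, hx₁, h⟩ := exists_S_le hRH
  obtain ⟨t₀, ht₀⟩ := Filter.eventually_atTop.1
    (((Real.tendsto_log_atTop.comp Real.tendsto_log_atTop).eventually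
      (eventually_parameter_conditions x₁)).and
      ((Real.tendsto_log_atTop.eventually_gt_atTop 0).and (Filter.eventually_ge_atTop 4)))
  refine ⟨23 + 2 * C, by positivity, t₀, fun t ht hord => ?_⟩
  obtain ⟨⟨hl, hlL, hLM, hLx⟩, hM, ht4⟩ := ht₀ t ht
  simp only [Function.comp_apply] at hl hlL hLM hLx
  rw [Real.exp_log hM] at hLM
  set M := Real.log t with hMdef
  set L := Real.log M with hLdef
  set l := Real.log L with hldef
  have hL : 8 ≤ L := by linarith
  have hK : 0 < L - 4 * l := by linarith
  have hx : 1 / (L - 4 * l) ≤ x₁ := by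
    rw [div_le_iff₀ hx₁] at hLx
    rw [div_le_iff₀ hK]
    nlinarith
  have hexp : Real.exp (1 / (1 / (L - 4 * l))) = M / L ^ 4 := by
    rw [one_div_one_div, Real.exp_sub, hLdef, Real.exp_log hM, ← hLdef,
      show 4 * l = ((4 : ℕ) : ℝ) * l by norm_num, Real.exp_nat_mul, hldef,
      Real.exp_log (by linarith)]
  have hP : Real.log (4 + t) ≤ M + 2 := by
    have h2 : Real.log (4 + t) ≤ Real.log (t * 2) := Real.log_le_log (by linarith) (by linarith)
    rw [Real.log_mul (by linarith) (by norm_num)] at h2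
    linarith [Real.log_two_lt_d9]
  have hmain := S_bound_le_of_parameters hC hl hlL hLM hP
  rw [← hexp] at hmain
  have ht0 : |t| = t := abs_of_nonneg (by linarith)
  obtain ⟨hz, hz'⟩ := riemannZeta₁_half_ne_zero (show (0 : ℝ) < t by linarith).ne' hord
  have hpos := h t _ (by positivity) hx (by rw [ht0]; linarith) hz
  have hneg := h (-t) _ (by positivity) hx (by rw [abs_neg, ht0]; linarith) hz'
  rw [S_neg, abs_neg, ht0] at hneg
  rw [ht0] at hpos
  rw [abs_le]
  constructor <;> linarith
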